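/- Let Delta, Delta', Delta'' be integer convex polytopes and let (P_0, Q_0, R_0) in P(Delta) x P(Delta') x P(Delta'') be such that the curve {P_0=0} is irreducible with exactly N nondegenerate double points t_1, ..., t_N in (C*)^2 and no other singular points, and the curves {Q_0=0} and {R_0=0} intersect transversely at each t_h. Let S'_1, ..., S'_N be the germs at (P_0, Q_0, R_0) of the smooth codimension-3 analytic submanifolds of P(Delta) x P(Delta') x P(Delta'') consisting of triples (P,Q,R) such that P has a double point near t_h at which both Q and R vanish. If 2N < b(Delta), then there exists a neighborhood W of (P_0, Q_0, R_0) such that the intersection S'_1 cap ... cap S'_N cap W is transversal in P(Delta) x P(Delta') x P(Delta''). -/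

import Mathlib

open MvPolynomial

/-- The coefficient space of polynomials with monomials in the finite lattice set `L`:
this is the space `P(Δ)` of polynomials with Newton polytope (contained in) `Δ`,
coordinatized by coefficients. -/
abbrev Coef (L : Finset (ℕ × ℕ)) : Type := {p : ℕ × ℕ // p ∈ L} → ℂ

/-- The polynomial with coefficient vector `c`. -/
noncomputable def toPoly {L : Finset (ℕ × ℕ)} (c : Coef L) : MvPolynomial (Fin 2) ℂ :=
  ∑ p : {p : ℕ × ℕ // p ∈ L},
    monomial (Finsupp.single 0 p.1.1 + Finsupp.single 1 p.1.2) (c p)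

/-- `z ∈ (ℂ*)²` is a singular point of the curve `{f = 0}`. -/
def IsSingAt (f : MvPolynomial (Fin 2) ℂ) (z : Fin 2 → ℂ) : Prop :=
  z 0 ≠ 0 ∧ z 1 ≠ 0 ∧ eval z f = 0 ∧
    eval z (pderiv 0 f) = 0 ∧ eval z (pderiv 1 f) = 0

/-- `z ∈ (ℂ*)²` is a nondegenerate double point (ordinary quadratic point, node)
of the curve `{f = 0}`. -/
def IsNodeAt (f : MvPolynomial (Fin 2) ℂ) (z : Fin 2 → ℂ) : Prop :=
  IsSingAt f z ∧
    eval z (pderiv 0 (pderiv 0 f)) * eval z (pderiv 1 (pderiv 1 f)) -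
      eval z (pderiv 0 (pderiv 1 f)) * eval z (pderiv 1 (pderiv 0 f)) ≠ 0

def toR (p : ℕ × ℕ) : ℝ × ℝ := ((p.1 : ℝ), (p.2 : ℝ))

/-- The convex hull of the lattice set `L`. -/
def hullOf (L : Finset (ℕ × ℕ)) : Set (ℝ × ℝ) := convexHull ℝ (toR '' L)

/-- `L` is exactly the set of lattice points of the integer convex polytope `conv L`. -/
def IsLatticePolytopeSet (L : Finset (ℕ × ℕ)) : Prop :=
  ∀ p : ℕ × ℕ, toR p ∈ hullOf L ↔ p ∈ L

/-- `b(Δ)`: the number of lattice points on the boundary of the polytope. -/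
noncomputable def boundaryLatticeCount (L : Finset (ℕ × ℕ)) : ℕ :=
  Set.ncard {p : ℕ × ℕ | toR p ∈ frontier (hullOf L)}

/-- Laurent polynomials in two variables. -/
abbrev Lau : Type := AddMonoidAlgebra ℂ (ℤ × ℤ)

/-- Doubly infinite formal Laurent series in two variables. -/
def Ser : Type := ℤ × ℤ → ℂ

namespace Ser

noncomputable instance : AddCommGroup Ser := inferInstanceAs (AddCommGroup (ℤ × ℤ → ℂ))

noncomputable instance : Module ℂ Ser := inferInstanceAs (Module ℂ (ℤ × ℤ → ℂ))

@[ext] theorem ext {s s' : Ser} (h : ∀ r, s r = s' r) : s = s' := funext h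

@[simp] theorem add_apply (s s' : Ser) (r : ℤ × ℤ) : (s + s') r = s r + s' r := rfl

@[simp] theorem sub_apply (s s' : Ser) (r : ℤ × ℤ) : (s - s') r = s r - s' r := rfl

@[simp] theorem zero_apply (r : ℤ × ℤ) : (0 : Ser) r = 0 := rfl

@[simp] theorem csmul_apply (c : ℂ) (s : Ser) (r : ℤ × ℤ) : (c • s) r = c * s r := rfl

theorem sum_apply {ι : Type*} (u : Finset ι) (s : ι → Ser) (r : ℤ × ℤ) :
    (∑ i ∈ u, s i) r = ∑ i ∈ u, s i r := Finset.sum_apply (M := fun _ => ℂ) r u s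

/-- Translation of a series by a lattice vector. -/
def shift (p : ℤ × ℤ) : Module.End ℂ Ser where
  toFun s := fun r => s (r - p)
  map_add' _ _ := rfl
  map_smul' _ _ := rfl

@[simp] theorem shift_apply (p : ℤ × ℤ) (s : Ser) (r : ℤ × ℤ) : shift p s r = s (r - p) := rfl

/-- The translation action of the lattice on series. -/
def shiftHom : Multiplicative (ℤ × ℤ) →* Module.End ℂ Ser where
  toFun p := shift p.toAdd
  map_one' := by
    ext s r
    simp
  map_mul' p q := by
    ext s r
    simp [sub_sub]

noncomputable instance : Module Lau Ser :=
  Module.compHom Ser (AddMonoidAlgebra.lift ℂ (Module.End ℂ Ser) (ℤ × ℤ) shiftHom).toRingHom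

theorem single_smul_apply (p : ℤ × ℤ) (c : ℂ) (s : Ser) (r : ℤ × ℤ) :
    ((AddMonoidAlgebra.single p c : Lau) • s) r = c * s (r - p) := by
  change (AddMonoidAlgebra.lift ℂ (Module.End ℂ Ser) (ℤ × ℤ) shiftHom
    (AddMonoidAlgebra.single p c) s) r = _
  rw [AddMonoidAlgebra.lift_single]
  rfl

instance : IsScalarTower ℂ Lau Ser where
  smul_assoc c F s := by
    change AddMonoidAlgebra.lift ℂ (Module.End ℂ Ser) (ℤ × ℤ) shiftHom (c • F) s =
      c • AddMonoidAlgebra.lift ℂ (Module.End ℂ Ser) (ℤ × ℤ) shiftHom F s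
    rw [map_smul]
    rfl

theorem smul_apply (F : Lau) (s : Ser) (r : ℤ × ℤ) :
    (F • s) r = F.coeff.sum fun p c => c * s (r - p) := by
  induction F using AddMonoidAlgebra.induction_linear with
  | zero => simp
  | add F G hF hG =>
    rw [add_smul, add_apply, hF, hG, AddMonoidAlgebra.coeff_add, Finsupp.sum_add_index']
    · simp
    · intros; ring
  | single p c =>
    rw [single_smul_apply, AddMonoidAlgebra.coeff_single, Finsupp.sum_single_index]
    simp

/-- The series supported at the origin with value one. -/
noncomputable def unit : Ser := (Pi.single 0 1 : ℤ × ℤ → ℂ)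

/-- A Laurent polynomial viewed as a series. -/
noncomputable def ofLau : Lau →ₗ[Lau] Ser := LinearMap.toSpanSingleton Lau Ser unit

@[simp] theorem ofLau_apply (F : Lau) (r : ℤ × ℤ) : ofLau F r = F.coeff r := by
  rw [ofLau, LinearMap.toSpanSingleton_apply, smul_apply, Finsupp.sum, Finset.sum_eq_single r]
  · simp [unit]
  · intro p _ hp
    have : r - p ≠ 0 := fun h => hp (sub_eq_zero.1 h).symm
    simp [unit, Pi.single_eq_of_ne this]
  · intro h
    simp [Finsupp.notMem_support_iff.1 h]

theorem ofLau_injective : Function.Injective ofLau := by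
  intro F G h
  apply AddMonoidAlgebra.coeff_injective
  ext r
  rw [← ofLau_apply, h, ofLau_apply]

theorem exists_ofLau_of_finite (s : Ser) (u : Finset (ℤ × ℤ)) (h : ∀ r, s r ≠ 0 → r ∈ u) :
    ∃ G : Lau, s = ofLau G := by
  refine ⟨.ofCoeff (Finsupp.onFinset u s h), ?_⟩
  ext r
  rw [ofLau_apply]
  rfl

/-- Restriction of a series to a set of exponents. -/
noncomputable def cut (S : Set (ℤ × ℤ)) : Ser →ₗ[ℂ] Ser where
  toFun s := S.indicator s
  map_add' s s' := Set.indicator_add S s s'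
  map_smul' c s := Set.indicator_const_smul S c s

open Classical in
theorem cut_apply (S : Set (ℤ × ℤ)) (s : Ser) (r : ℤ × ℤ) :
    cut S s r = if r ∈ S then s r else 0 := Set.indicator_apply S s r

/-- Exponents which are nonpositive for the lexicographic order. -/
def lexNonpos : Set (ℤ × ℤ) := {r | r.1 < 0 ∨ (r.1 = 0 ∧ r.2 ≤ 0)}

/-- The series with finitely many nonzero coefficients in each column. -/
noncomputable def colFinite : Submodule Lau Ser where
  carrier := {s | ∀ n : ℤ, {m : ℤ | s (n, m) ≠ 0}.Finite}
  zero_mem' := by intro n; simp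
  add_mem' := by
    intro s s' h h' n
    refine ((h n).union (h' n)).subset fun m hm => ?_
    by_contra hc
    simp only [Set.mem_union, Set.mem_ofPred_eq, not_or, not_not] at hc
    exact hm (by simp [hc.1, hc.2])
  smul_mem' := by
    intro F s h n
    have : {m : ℤ | (F • s) (n, m) ≠ 0} ⊆
        ⋃ p ∈ F.coeff.support, (fun m => m - p.2) ⁻¹' {m | s (n - p.1, m) ≠ 0} := by
      intro m hm
      simp only [Set.mem_ofPred_eq, smul_apply, Finsupp.sum] at hm
      obtain ⟨p, hp, hne⟩ := Finset.exists_ne_zero_of_sum_ne_zero hm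
      simp only [Set.mem_iUnion]
      exact ⟨p, hp, right_ne_zero_of_mul hne⟩
    refine Set.Finite.subset (Set.Finite.biUnion F.coeff.support.finite_toSet ?_) this
    intro p _
    exact (h (n - p.1)).preimage (sub_left_injective.injOn)

theorem exists_cut_smul (s : Ser) (hs : s ∈ colFinite) (F : Lau) :
    ∃ G : Lau, cut lexNonpos (F • s) = F • cut lexNonpos s + ofLau G := by
  induction F using AddMonoidAlgebra.induction_linear with
  | zero => exact ⟨0, by simp⟩
  | add F F' hF hF' =>
    obtain ⟨G, hG⟩ := hF
    obtain ⟨G', hG'⟩ := hF'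
    exact ⟨G + G', by rw [add_smul, map_add, hG, hG', map_add, add_smul]; abel⟩
  | single p c =>
    obtain ⟨G, hG⟩ := exists_ofLau_of_finite
      (cut lexNonpos ((AddMonoidAlgebra.single p c : Lau) • s) -
        (AddMonoidAlgebra.single p c : Lau) • cut lexNonpos s)
      ((Set.Finite.biUnion (Set.finite_Icc (min 0 p.1) (max 0 p.1)) (t := fun n =>
        (fun m : ℤ => (n, m + p.2)) '' {m | s (n - p.1, m) ≠ 0})
        (fun n _ => (hs (n - p.1)).image _)).toFinset) (by
      intro r hr
      simp only [Set.Finite.mem_toFinset, Set.mem_iUnion]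
      rw [sub_apply, cut_apply, single_smul_apply, single_smul_apply, cut_apply] at hr
      refine ⟨r.1, ?_, r.2 - p.2, ?_, by simp⟩
      · rw [Set.mem_Icc]
        by_contra hc
        apply hr
        have : r ∈ lexNonpos ↔ r - p ∈ lexNonpos := by
          simp only [lexNonpos, Set.mem_ofPred_eq, Prod.fst_sub, Prod.snd_sub]
          omega
        by_cases h : r ∈ lexNonpos
        · simp [h, this.1 h]
        · simp [h, mt this.2 h]
      · simp only [Set.mem_ofPred_eq]
        intro h0
        have : s (r - p) = 0 := h0
        simp [this] at hr)
    exact ⟨G, by rw [← hG]; abel⟩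

/-- The exponents lying weakly below the graph determined by `c`. -/
def below (c : ℤ → ℤ) : Set (ℤ × ℤ) := {r | r.2 ≤ c r.1}

theorem cut_below_smul_sub_mem (c : ℤ → ℤ) (F : Lau) (s : Ser) :
    cut (below c) (F • s) - F • cut (below c) s ∈ colFinite := by
  induction F using AddMonoidAlgebra.induction_linear with
  | zero => simp
  | add F F' hF hF' =>
    have := add_mem hF hF'
    convert this using 1
    rw [add_smul, map_add, add_smul]; abel
  | single p a =>
    intro n
    refine (Set.finite_Icc (min (c n) (p.2 + c (n - p.1))) (max (c n) (p.2 + c (n - p.1)))).subset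
      fun m hm => ?_
    by_contra hc
    apply hm
    rw [Set.mem_Icc] at hc
    rw [sub_apply, cut_apply, single_smul_apply, single_smul_apply, cut_apply]
    have : ((n, m) : ℤ × ℤ) ∈ below c ↔ (n, m) - p ∈ below c := by
      simp only [below, Set.mem_ofPred_eq, Prod.fst_sub, Prod.snd_sub]
      omega
    by_cases h : ((n, m) : ℤ × ℤ) ∈ below c
    · simp [h, this.1 h]
    · simp [h, mt this.2 h]

theorem smul_cut_below_mem (c : ℤ → ℤ) {F : Lau} {A : Ser} (h : F • A = 0) :
    F • cut (below c) A ∈ colFinite := by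
  have := cut_below_smul_sub_mem c F A
  rw [h, map_zero, zero_sub] at this
  exact neg_mem_iff.1 this

/-- The residue-type bracket `F π(H B) - H π(F B)`. -/
noncomputable def bracket (B : Ser) (F H : Lau) : Ser :=
  F • cut lexNonpos (H • B) - H • cut lexNonpos (F • B)

theorem bracket_self (B : Ser) (F : Lau) : bracket B F F = 0 := sub_self _

theorem bracket_swap (B : Ser) (F H : Lau) : bracket B F H = -bracket B H F := by
  simp [bracket]

theorem bracket_add_left (B : Ser) (F F' H : Lau) :
    bracket B (F + F') H = bracket B F H + bracket B F' H := by
  simp only [bracket, add_smul, map_add, smul_add]; abel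

theorem smul_comm' (c : ℂ) (F : Lau) (s : Ser) : F • (c • s) = c • (F • s) := by
  ext r
  rw [csmul_apply, smul_apply, smul_apply, Finsupp.mul_sum]
  apply Finsupp.sum_congr
  intros
  rw [csmul_apply]; ring

theorem bracket_smul_left (B : Ser) (c : ℂ) (F H : Lau) :
    bracket B (c • F) H = c • bracket B F H := by
  simp only [bracket, smul_assoc, map_smul, smul_comm', smul_sub]

theorem exists_bracket_mul_right {B : Ser} {P : Lau} (hP : P • B ∈ colFinite) (g : Lau) :
    ∃ κ : Lau, ∀ F, bracket B F (P * g) = g • bracket B F P + ofLau (F * κ) := by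
  obtain ⟨κ, hκ⟩ := exists_cut_smul _ hP g
  refine ⟨κ, fun F => ?_⟩
  rw [bracket, bracket, mul_comm P g, mul_smul g P B, hκ, ← smul_eq_mul F κ, ofLau.map_smul,
    smul_add, mul_smul]
  module

theorem bracket_mul_right_of_eq_zero {B : Ser} {P : Lau} (hP0 : P ≠ 0)
    (hP : P • B ∈ colFinite) (g : Lau) (h : bracket B P (P * g) = 0) (F : Lau) :
    bracket B F (P * g) = g • bracket B F P := by
  obtain ⟨κ, hκ⟩ := exists_bracket_mul_right hP g
  have h1 := hκ P
  rw [h, bracket_self, smul_zero, zero_add] at h1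
  have : P * κ = 0 := ofLau_injective (by rw [← h1, map_zero])
  have hk : κ = 0 := (mul_eq_zero.1 this).resolve_left hP0
  rw [hκ F, hk]
  simp

end Ser

namespace Ser

/-- The monomial with exponent `p` evaluated at a point of the torus. -/
noncomputable def chr (t : ℂˣ × ℂˣ) (p : ℤ × ℤ) : ℂ := ((t.1 ^ p.1 * t.2 ^ p.2 : ℂˣ) : ℂ)

theorem chr_zero (t : ℂˣ × ℂˣ) : chr t 0 = 1 := by simp [chr]

theorem chr_add (t : ℂˣ × ℂˣ) (p q : ℤ × ℤ) : chr t (p + q) = chr t p * chr t q := by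
  simp only [chr, Prod.fst_add, Prod.snd_add, zpow_add]
  push_cast
  ring

theorem chr_ne_zero (t : ℂˣ × ℂˣ) (p : ℤ × ℤ) : chr t p ≠ 0 := Units.ne_zero _

/-- Evaluation of Laurent polynomials at a point of the torus. -/
noncomputable def ev (t : ℂˣ × ℂˣ) : Lau →ₐ[ℂ] ℂ :=
  AddMonoidAlgebra.lift ℂ ℂ (ℤ × ℤ)
    { toFun p := chr t p.toAdd
      map_one' := chr_zero t
      map_mul' p q := chr_add t p.toAdd q.toAdd }

@[simp] theorem ev_single (t : ℂˣ × ℂˣ) (p : ℤ × ℤ) (c : ℂ) :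
    ev t (AddMonoidAlgebra.single p c) = c * chr t p := by
  rw [ev, AddMonoidAlgebra.lift_single]
  rfl

/-- The series annihilated by all Laurent polynomials vanishing at `t`. -/
noncomputable def delta (t : ℂˣ × ℂˣ) : Ser := fun r => chr t (-r)

theorem delta_apply (t : ℂˣ × ℂˣ) (r : ℤ × ℤ) : delta t r = chr t (-r) := rfl

/-- A weighted form of the series `delta`. -/
noncomputable def moment (t : ℂˣ × ℂˣ) (w : ℤ × ℤ →+ ℂ) : Ser := fun r => w (-r) * chr t (-r)

theorem moment_apply (t : ℂˣ × ℂˣ) (w : ℤ × ℤ →+ ℂ) (r : ℤ × ℤ) :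
    moment t w r = w (-r) * chr t (-r) := rfl

theorem smul_delta (t : ℂˣ × ℂˣ) (F : Lau) : F • delta t = ev t F • delta t := by
  induction F using AddMonoidAlgebra.induction_linear with
  | zero => simp
  | add F G hF hG => rw [add_smul, hF, hG, map_add, add_smul]
  | single p c =>
    ext r
    rw [single_smul_apply, ev_single, csmul_apply, delta_apply, delta_apply, neg_sub,
      sub_eq_add_neg, chr_add]
    ring

/-- The logarithmic derivative at `t` in the direction `w`. -/
noncomputable def dEv (t : ℂˣ × ℂˣ) (w : ℤ × ℤ →+ ℂ) : Lau →ₗ[ℂ] ℂ where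
  toFun F := (F • moment t w) 0
  map_add' F G := by rw [add_smul, add_apply]
  map_smul' c F := by rw [smul_assoc, csmul_apply]; rfl

theorem dEv_apply (t : ℂˣ × ℂˣ) (w : ℤ × ℤ →+ ℂ) (F : Lau) : dEv t w F = (F • moment t w) 0 := rfl

@[simp] theorem dEv_single (t : ℂˣ × ℂˣ) (w : ℤ × ℤ →+ ℂ) (p : ℤ × ℤ) (c : ℂ) :
    dEv t w (AddMonoidAlgebra.single p c) = c * (w p * chr t p) := by
  rw [dEv_apply, single_smul_apply, moment_apply]
  simp

theorem smul_moment (t : ℂˣ × ℂˣ) (w : ℤ × ℤ →+ ℂ) (F : Lau) :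
    F • moment t w = ev t F • moment t w + dEv t w F • delta t := by
  induction F using AddMonoidAlgebra.induction_linear with
  | zero => simp
  | add F G hF hG => rw [add_smul, hF, hG, map_add, map_add]; module
  | single p c =>
    ext r
    rw [single_smul_apply, ev_single, add_apply, csmul_apply, csmul_apply, delta_apply,
      moment_apply, moment_apply, dEv_single, neg_sub, sub_eq_add_neg, chr_add, map_add]
    ring

theorem dEv_mul (t : ℂˣ × ℂˣ) (w : ℤ × ℤ →+ ℂ) (F G : Lau) :
    dEv t w (F * G) = ev t F * dEv t w G + dEv t w F * ev t G := by
  have h : (delta t) 0 = 1 := by rw [delta_apply, neg_zero, chr_zero]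
  rw [dEv_apply, mul_smul, smul_moment, smul_add, smul_comm', smul_comm', add_apply, csmul_apply,
    csmul_apply, ← dEv_apply, smul_delta, csmul_apply, h]
  ring

/-- The function `z₁ - t₁`. -/
noncomputable def zetaX (t : ℂˣ × ℂˣ) : Lau :=
  AddMonoidAlgebra.single (1, 0) 1 - AddMonoidAlgebra.single 0 (t.1 : ℂ)

/-- The function `z₂ - t₂`. -/
noncomputable def zetaY (t : ℂˣ × ℂˣ) : Lau :=
  AddMonoidAlgebra.single (0, 1) 1 - AddMonoidAlgebra.single 0 (t.2 : ℂ)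

theorem ev_zetaX (t s : ℂˣ × ℂˣ) : ev t (zetaX s) = t.1 - s.1 := by
  simp [zetaX, chr]

theorem ev_zetaY (t s : ℂˣ × ℂˣ) : ev t (zetaY s) = t.2 - s.2 := by
  simp [zetaY, chr]

theorem dEv_zetaX (t s : ℂˣ × ℂˣ) (w : ℤ × ℤ →+ ℂ) : dEv t w (zetaX s) = w (1, 0) * t.1 := by
  simp [zetaX, chr]

theorem dEv_zetaY (t s : ℂˣ × ℂˣ) (w : ℤ × ℤ →+ ℂ) : dEv t w (zetaY s) = w (0, 1) * t.2 := by
  simp [zetaY, chr]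

theorem exists_eq_zeta_mul_add (t : ℂˣ × ℂˣ) (F : Lau) (hF : ev t F = 0) :
    ∃ F₁ F₂ : Lau, F = zetaX t * F₁ + zetaY t * F₂ := by
  set I : Ideal Lau := Ideal.span {zetaX t, zetaY t} with hI
  have key : ∀ F : Lau, F - AddMonoidAlgebra.single 0 (ev t F) ∈ I := by
    have hX : (AddMonoidAlgebra.single (1, 0) 1 - AddMonoidAlgebra.single 0 (t.1 : ℂ) : Lau) ∈ I :=
      Ideal.subset_span (by simp [zetaX])
    have hY : (AddMonoidAlgebra.single (0, 1) 1 - AddMonoidAlgebra.single 0 (t.2 : ℂ) : Lau) ∈ I :=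
      Ideal.subset_span (by simp [zetaY])
    let Z : AddSubgroup (ℤ × ℤ) :=
      { carrier := {p | (AddMonoidAlgebra.single p 1 - AddMonoidAlgebra.single 0 (chr t p) : Lau)
          ∈ I}
        zero_mem' := by simp [chr_zero]
        add_mem' := by
          intro p q hp hq
          simp only [Set.mem_ofPred_eq] at *
          have := add_mem (I.mul_mem_left (AddMonoidAlgebra.single q 1) hp)
            (I.mul_mem_left (AddMonoidAlgebra.single 0 (chr t p)) hq)
          convert this using 1
          simp only [mul_sub, AddMonoidAlgebra.single_mul_single, chr_add]
          simp [add_comm]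
        neg_mem' := by
          intro p hp
          simp only [Set.mem_ofPred_eq] at *
          have := I.mul_mem_left (AddMonoidAlgebra.single (-p) (-chr t (-p))) hp
          convert this using 1
          have h1 : chr t (-p) * chr t p = 1 := by rw [← chr_add]; simp [chr_zero]
          simp only [mul_sub, AddMonoidAlgebra.single_mul_single]
          simp [h1, AddMonoidAlgebra.single_neg]
          abel }
    have hZ : ∀ p, p ∈ Z := by
      intro p
      have h1 : ((1, 0) : ℤ × ℤ) ∈ Z := by
        change _ ∈ I
        simpa [chr] using hX
      have h2 : ((0, 1) : ℤ × ℤ) ∈ Z := by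
        change _ ∈ I
        simpa [chr] using hY
      have := add_mem (zsmul_mem h1 p.1) (zsmul_mem h2 p.2)
      simpa using this
    intro F
    induction F using AddMonoidAlgebra.induction_linear with
    | zero => simp
    | add F G hF hG =>
      have := add_mem hF hG
      convert this using 1
      rw [map_add, AddMonoidAlgebra.single_add]
      abel
    | single p c =>
      have := I.mul_mem_left (AddMonoidAlgebra.single 0 c) (hZ p)
      convert this using 1
      simp [mul_sub, AddMonoidAlgebra.single_mul_single]
  have := key F
  rw [hF, AddMonoidAlgebra.single_zero, sub_zero, hI, Ideal.mem_span_pair] at this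
  obtain ⟨a, b, h⟩ := this
  exact ⟨a, b, by rw [← h]; ring⟩

/-- The lower half of the series `delta`. -/
noncomputable def halfDelta (t : ℂˣ × ℂˣ) : Ser := cut (below fun _ => 0) (delta t)

theorem zetaX_smul_halfDelta (t : ℂˣ × ℂˣ) : zetaX t • halfDelta t = 0 := by
  ext r
  rw [zetaX, sub_smul, sub_apply, single_smul_apply, single_smul_apply, halfDelta, cut_apply,
    cut_apply, delta_apply, delta_apply]
  have : chr t (-(r - (1, 0))) = chr t (-r) * t.1 := by
    rw [neg_sub, sub_eq_add_neg, add_comm, chr_add]; simp [chr]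
  simp only [below, Set.mem_ofPred_eq, Prod.snd_sub, sub_zero, this]
  split_ifs <;> simp [mul_comm]

/-- The series `z₂ ∑ (z₁ / t₁)^n`. -/
noncomputable def rowSeries (t : ℂˣ × ℂˣ) : Ser := zetaY t • halfDelta t

theorem rowSeries_apply (t : ℂˣ × ℂˣ) (r : ℤ × ℤ) :
    rowSeries t r = if r.2 = 1 then chr t (-r) * t.2 else 0 := by
  rw [rowSeries, zetaY, sub_smul, sub_apply, single_smul_apply, single_smul_apply, halfDelta,
    cut_apply, cut_apply, delta_apply, delta_apply]
  have : chr t (-(r - (0, 1))) = chr t (-r) * t.2 := by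
    rw [neg_sub, sub_eq_add_neg, add_comm, chr_add]; simp [chr]
  simp only [below, Set.mem_ofPred_eq, Prod.snd_sub, this, sub_zero]
  split_ifs <;> first | omega | simp [mul_comm]

theorem rowSeries_mem (t : ℂˣ × ℂˣ) : rowSeries t ∈ colFinite := by
  intro n
  refine (Set.finite_singleton (1 : ℤ)).subset fun m hm => ?_
  by_contra h
  apply hm
  rw [rowSeries_apply]
  exact if_neg h

theorem zetaX_smul_cut_rowSeries (t : ℂˣ × ℂˣ) :
    zetaX t • cut lexNonpos (rowSeries t) = ofLau (AddMonoidAlgebra.single (0, 1) (t.1 : ℂ)) := by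
  ext r
  rw [zetaX, sub_smul, sub_apply, single_smul_apply, single_smul_apply, ofLau_apply, cut_apply,
    cut_apply, rowSeries_apply, rowSeries_apply]
  have : chr t (-(r - (1, 0))) = chr t (-r) * t.1 := by
    rw [neg_sub, sub_eq_add_neg, add_comm, chr_add]; simp [chr]
  rw [AddMonoidAlgebra.coeff_single, Finsupp.single_apply]
  obtain ⟨r1, r2⟩ := r
  simp only [lexNonpos, Set.mem_ofPred_eq, Prod.snd_sub, Prod.fst_sub, sub_zero, this,
    Prod.mk.injEq]
  by_cases h2 : r2 = 1
  · subst h2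
    by_cases h1 : r1 = 0
    · subst h1
      simp [chr]
      field_simp
    · have h3 : (r1 - 1 < 0 ∨ r1 - 1 = 0 ∧ (1 : ℤ) ≤ 0) ↔ r1 < 0 := by omega
      have h4 : (r1 < 0 ∨ r1 = 0 ∧ (1 : ℤ) ≤ 0) ↔ r1 < 0 := by omega
      simp only [h3, h4, Ne.symm h1, false_and, if_false]
      split_ifs
      · simp only [one_mul]
        ring
      · simp
  · simp [h2, Ne.symm h2]

theorem eq_smul_rowSeries {t : ℂˣ × ℂˣ} {F F₁ F₂ : Lau} (h : F = zetaX t * F₁ + zetaY t * F₂) :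
    F • halfDelta t = F₂ • rowSeries t := by
  rw [h, add_smul, mul_comm, mul_smul, zetaX_smul_halfDelta, mul_comm, mul_smul, ← rowSeries]
  simp

theorem bracket_ne_of_smul_sub_mem {P f : Lau} (hP : Prime P) (hPf : ¬ P ∣ f) (t : ℂˣ × ℂˣ)
    (hPt : ev t P = 0) (hft : ev t f = 0) {B : Ser} (hPB : P • B ∈ colFinite)
    (hfB : f • B ∈ colFinite) (g : Lau) {c : ℂ} (hc : c ≠ 0)
    (hg : g • B - c • halfDelta t ∈ colFinite) (α β : Lau) :
    bracket B f P ≠ ofLau (α * P + β * f) := by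
  intro h
  obtain ⟨P₁, P₂, hP12⟩ := exists_eq_zeta_mul_add t P hPt
  obtain ⟨f₁, f₂, hf12⟩ := exists_eq_zeta_mul_add t f hft
  obtain ⟨D, hD, hgB⟩ : ∃ D ∈ colFinite, g • B = c • halfDelta t + D := ⟨_, hg, by abel⟩
  set η : Lau := AddMonoidAlgebra.single (0, 1) (t.1 : ℂ) with hη
  obtain ⟨C₁, hC₁⟩ := exists_cut_smul _ hPB g
  obtain ⟨C₂, hC₂⟩ := exists_cut_smul _ hfB g
  obtain ⟨C₃, hC₃⟩ := exists_cut_smul _ hD P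
  obtain ⟨C₄, hC₄⟩ := exists_cut_smul _ hD f
  obtain ⟨C₅, hC₅⟩ := exists_cut_smul _ (rowSeries_mem t) P₂
  obtain ⟨C₆, hC₆⟩ := exists_cut_smul _ (rowSeries_mem t) f₂
  have e1 : g • cut lexNonpos (P • B) + ofLau C₁ =
      c • (P₂ • cut lexNonpos (rowSeries t) + ofLau C₅) + (P • cut lexNonpos D + ofLau C₃) := by
    rw [← hC₁, smul_comm, hgB, smul_add, map_add, smul_comm', map_smul, hC₃,
      eq_smul_rowSeries hP12, hC₅]
  have e2 : g • cut lexNonpos (f • B) + ofLau C₂ =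
      c • (f₂ • cut lexNonpos (rowSeries t) + ofLau C₆) + (f • cut lexNonpos D + ofLau C₄) := by
    rw [← hC₂, smul_comm, hgB, smul_add, map_add, smul_comm', map_smul, hC₄,
      eq_smul_rowSeries hf12, hC₆]
  have e3 : ofLau (g * (α * P + β * f) + f * C₁ - P * C₂) =
      ofLau (c • (η * (f₁ * P₂ - P₁ * f₂)) + c • (f * C₅ - P * C₆) + f * C₃ - P * C₄) := by
    have l1 : ofLau (g * (α * P + β * f) + f * C₁ - P * C₂) =
        f • (g • cut lexNonpos (P • B) + ofLau C₁) - P • (g • cut lexNonpos (f • B) + ofLau C₂) := by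
      rw [map_sub, map_add, ← smul_eq_mul g, ofLau.map_smul, ← h, bracket, ← smul_eq_mul f,
        ofLau.map_smul, ← smul_eq_mul P, ofLau.map_smul]
      module
    have l2 : f • (P₂ • cut lexNonpos (rowSeries t)) - P • (f₂ • cut lexNonpos (rowSeries t)) =
        ofLau (η * (f₁ * P₂ - P₁ * f₂)) := by
      rw [mul_comm, ← smul_eq_mul, ofLau.map_smul, hη, ← zetaX_smul_cut_rowSeries, ← mul_smul,
        ← mul_smul, ← mul_smul, ← sub_smul]
      congr 1
      rw [hP12, hf12]
      ring
    have l3 : ∀ G : Lau, ofLau (c • G) = c • ofLau G := by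
      intro G
      ext r
      simp
    rw [l1, e1, e2, map_sub, map_add, map_add, l3, l3, ← l2, map_sub, ← smul_eq_mul f C₅,
      ← smul_eq_mul P C₆, ← smul_eq_mul f C₃, ← smul_eq_mul P C₄, ofLau.map_smul, ofLau.map_smul,
      ofLau.map_smul, ofLau.map_smul, smul_add, smul_add, smul_add, smul_add, smul_comm',
      smul_comm', smul_add, smul_add]
    module
  have e4 := ofLau_injective e3
  obtain ⟨a, b, hab⟩ : ∃ a b : Lau, η * (f₁ * P₂ - P₁ * f₂) = a * P + b * f := by
    refine ⟨c⁻¹ • (g * α - C₂ + c • C₆ + C₄), c⁻¹ • (g * β + C₁ - c • C₅ - C₃), ?_⟩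
    have : c • (η * (f₁ * P₂ - P₁ * f₂)) = (g * α - C₂ + c • C₆ + C₄) * P +
        (g * β + C₁ - c • C₅ - C₃) * f := by
      simp only [Algebra.smul_def] at e4 ⊢
      linear_combination -e4
    rw [smul_mul_assoc, smul_mul_assoc, ← smul_add, ← this, inv_smul_smul₀ hc]
  have hdiv : ∀ q : Lau, ∀ q' : Lau, f * q = q' * P → P ∣ q := by
    intro q q' hq
    exact (hP.dvd_or_dvd ⟨q', by rw [hq, mul_comm]⟩).resolve_left hPf
  have hη0 : η ≠ 0 := by
    intro h0
    have := congrArg (ev t) h0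
    rw [hη, ev_single, map_zero] at this
    exact mul_ne_zero (Units.ne_zero _) (chr_ne_zero _ _) this
  have r1 : P ∣ η * P₁ + b * zetaY t := by
    apply hdiv _ (η * f₁ - a * zetaY t)
    apply mul_left_cancel₀ hη0
    linear_combination η * (η * P₁ + b * zetaY t) * hf12 - η * (η * f₁ - a * zetaY t) * hP12 -
      η * zetaY t * hab - η * zetaY t * (b * hf12 + a * hP12)
  have r2 : P ∣ η * P₂ - b * zetaX t := by
    apply hdiv _ (η * f₂ + a * zetaX t)
    apply mul_left_cancel₀ hη0
    linear_combination η * (η * P₂ - b * zetaX t) * hf12 - η * (η * f₂ + a * zetaX t) * hP12 +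
      η * zetaX t * hab + η * zetaX t * (b * hf12 + a * hP12)
  obtain ⟨q₁, hq₁⟩ := r1
  obtain ⟨q₂, hq₂⟩ := r2
  have h5 : P * (zetaX t * q₁ + zetaY t * q₂) = P * η := by
    linear_combination -zetaX t * hq₁ - zetaY t * hq₂ - η * hP12
  have h6 := mul_left_cancel₀ hP.ne_zero h5
  have h7 := congrArg (ev t) h6
  rw [map_add, map_mul, map_mul, ev_zetaX, ev_zetaY, hη, ev_single] at h7
  simp only [sub_self, zero_mul, add_zero] at h7
  exact mul_ne_zero (Units.ne_zero _) (chr_ne_zero _ _) h7.symm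

end Ser

/-- The inclusion of the lattice in the plane. -/
def latPt (p : ℤ × ℤ) : ℝ × ℝ := ((p.1 : ℝ), (p.2 : ℝ))

/-- Points at which no nonzero linear functional attains its maximum over `K`. -/
def Inn (K : Set (ℝ × ℝ)) : Set (ℝ × ℝ) :=
  {v | ∀ α β : ℝ, (α ≠ 0 ∨ β ≠ 0) → ∃ k ∈ K, α * v.1 + β * v.2 < α * k.1 + β * k.2}

/-- A function on columns recording where a vertical ray enters the plane region `K`. -/
structure IsColumnCut (K : Set (ℝ × ℝ)) (c : ℤ → ℤ) : Prop where
  exists_lt : ∀ (n m : ℤ) (x y : ℝ), c n ≤ m → ((n : ℝ), y) ∈ K → (∃ z, (x, z) ∈ K) → n < x →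
    ∃ y' : ℝ, y' < m ∧ ((n : ℝ), y') ∈ K
  le_of_lt : ∀ (n m : ℤ) (x y : ℝ), ((n : ℝ), y) ∈ K → y < m → (∃ z, (x, z) ∈ K) → n < x → c n ≤ m
  lt_last : ∀ (n : ℤ) (y : ℝ), (∀ k ∈ K, k.1 ≤ n) → ((n : ℝ), y) ∈ K → y < c n

theorem exists_isColumnCut (K : Set (ℝ × ℝ)) (M : ℝ) (hM : ∀ k ∈ K, |k.2| < M) :
    ∃ c, IsColumnCut K c := by
  have key : ∀ n : ℤ, ∃ c : ℤ,
      ((∃ k ∈ K, (n : ℝ) < k.1) → (∃ y, ((n : ℝ), y) ∈ K) →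
        ∀ m : ℤ, c ≤ m ↔ ∃ y : ℝ, y < m ∧ ((n : ℝ), y) ∈ K) ∧
      ((¬ ∃ k ∈ K, (n : ℝ) < k.1) → ∀ y, ((n : ℝ), y) ∈ K → y < c) := by
    intro n
    by_cases h : ∃ k ∈ K, (n : ℝ) < k.1
    · by_cases h' : ∃ y, ((n : ℝ), y) ∈ K
      · obtain ⟨y, hy⟩ := h'
        obtain ⟨c, hc, hc'⟩ := Int.exists_least_of_bdd
          (P := fun m : ℤ => ∃ y : ℝ, y < m ∧ ((n : ℝ), y) ∈ K) (by
            refine ⟨⌊-M⌋, fun z hz => ?_⟩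
            obtain ⟨y', hy', hyK⟩ := hz
            have := (abs_lt.1 (hM _ hyK)).1
            simp only at this
            have h2 : (-M : ℝ) ≤ z := by linarith
            have h3 := Int.floor_le (-M)
            exact_mod_cast h3.trans h2) (by
            refine ⟨⌊y⌋ + 1, y, ?_, hy⟩
            push_cast
            exact Int.lt_floor_add_one y)
        refine ⟨c, fun _ _ m => ⟨fun hm => ?_, fun hm => hc' m hm⟩, fun h2 => absurd h h2⟩
        obtain ⟨y', h1, h2⟩ := hc
        exact ⟨y', h1.trans_le (by exact_mod_cast hm), h2⟩
      · exact ⟨0, fun _ h2 => absurd h2 h', fun h2 => absurd h h2⟩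
    · refine ⟨⌈M⌉, fun h2 => absurd h2 h, fun _ y hy => ?_⟩
      have := (abs_lt.1 (hM _ hy)).2
      simp only at this
      exact this.trans_le (Int.le_ceil M)
  choose c h1 h2 using key
  refine ⟨c, ⟨?_, ?_, ?_⟩⟩
  · rintro n m x y hm hy ⟨z, hz⟩ hx
    exact (h1 n ⟨_, hz, hx⟩ ⟨y, hy⟩ m).1 hm
  · rintro n m x y hy hm ⟨z, hz⟩ hx
    exact (h1 n ⟨_, hz, hx⟩ ⟨y, hy⟩ m).2 ⟨y, hm, hy⟩
  · intro n y h hy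
    exact h2 n (by push Not; exact h) y hy

/-- A point of a segment on a given vertical line. -/
theorem exists_mem_column {K : Set (ℝ × ℝ)} (hK : Convex ℝ K) {q p : ℝ × ℝ} (hq : q ∈ K)
    (hp : p ∈ K) (hqp : q.1 < p.1) {x : ℝ} (hqx : q.1 ≤ x) (hxp : x ≤ p.1) :
    ∃ s, (x, s) ∈ K ∧ ∀ α β m : ℝ, m ≤ α * q.1 + β * q.2 → m ≤ α * p.1 + β * p.2 →
      m ≤ α * x + β * s := by
  have hd : 0 < p.1 - q.1 := by linarith
  set a := (p.1 - x) / (p.1 - q.1) with ha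
  set b := (x - q.1) / (p.1 - q.1) with hb
  have ha0 : 0 ≤ a := div_nonneg (by linarith) hd.le
  have hb0 : 0 ≤ b := div_nonneg (by linarith) hd.le
  have hab : a + b = 1 := by rw [ha, hb]; field_simp; ring
  have hx : a * q.1 + b * p.1 = x := by rw [ha, hb]; field_simp; ring
  refine ⟨a * q.2 + b * p.2, ?_, ?_⟩
  · have := hK hq hp ha0 hb0 hab
    convert this using 1
    ext <;> simp [hx]
  · intro α β m h1 h2
    have h3 := mul_le_mul_of_nonneg_left h1 ha0
    have h4 := mul_le_mul_of_nonneg_left h2 hb0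
    have : α * x + β * (a * q.2 + b * p.2) =
        a * (α * q.1 + β * q.2) + b * (α * p.1 + β * p.2) := by rw [← hx]; ring
    rw [this]
    have : m = a * m + b * m := by rw [← add_mul, hab, one_mul]
    linarith

theorem mem_of_column {K : Set (ℝ × ℝ)} (hK : Convex ℝ K) {x y y' z : ℝ} (h : (x, y) ∈ K)
    (h' : (x, y') ∈ K) (h1 : y ≤ z) (h2 : z ≤ y') : (x, z) ∈ K := by
  rcases eq_or_lt_of_le (h1.trans h2) with h3 | h3
  · have : z = y := by linarith
    rwa [this]
  · have hd : 0 < y' - y := by linarith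
    have := hK h h' (a := (y' - z) / (y' - y)) (b := (z - y) / (y' - y))
      (div_nonneg (by linarith) hd.le) (div_nonneg (by linarith) hd.le) (by field_simp; ring)
    convert this using 1
    ext
    · simp only [Prod.fst_add, Prod.smul_fst, smul_eq_mul]; field_simp; ring
    · simp only [Prod.snd_add, Prod.smul_snd, smul_eq_mul]; field_simp; ring

/-- `q` precedes `u`, which weakly precedes `p`, in the lexicographic order. -/
def Crosses (q u p : ℤ × ℤ) : Prop :=
  (q.1 < u.1 ∨ (q.1 = u.1 ∧ q.2 < u.2)) ∧ (u.1 < p.1 ∨ (u.1 = p.1 ∧ u.2 ≤ p.2))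

theorem crosses_dichotomy_of_le {K : Set (ℝ × ℝ)} (hK : Convex ℝ K) {c : ℤ → ℤ}
    (hc : IsColumnCut K c) (u : ℤ × ℤ) (α β : ℝ) (hαβ : α ≠ 0 ∨ β ≠ 0)
    (hsep : ∀ k ∈ K, α * k.1 + β * k.2 ≤ α * u.1 + β * u.2) :
    (∀ p q, latPt p ∈ K → latPt q ∈ K → Crosses q u p →
      c (p + q - u).1 ≤ (p + q - u).2 → latPt (p + q - u) ∈ K) ∨
    (∀ p q, latPt p ∈ K → latPt q ∈ K → Crosses q u p →
      (p + q - u).2 < c (p + q - u).1 → latPt (p + q - u) ∈ K) := by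
  have main : ∀ p q, latPt p ∈ K → latPt q ∈ K → Crosses q u p →
      latPt (p + q - u) ∈ K ∨ ((β > 0 ∨ β = 0 ∧ α < 0) → ¬ c (p + q - u).1 ≤ (p + q - u).2) ∧
        ((β < 0 ∨ β = 0 ∧ 0 < α) → ¬ (p + q - u).2 < c (p + q - u).1) := by
    intro p q hp hq hcr
    obtain ⟨v, hv⟩ : ∃ v, v = p + q - u := ⟨_, rfl⟩
    rw [← hv]
    have hv1 : v.1 = p.1 + q.1 - u.1 := by rw [hv]; simp
    have hv2 : v.2 = p.2 + q.2 - u.2 := by rw [hv]; simp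
    have hv1' : (v.1 : ℝ) = p.1 + q.1 - u.1 := by rw [hv1]; push_cast; ring
    have hv2' : (v.2 : ℝ) = p.2 + q.2 - u.2 := by rw [hv2]; push_cast; ring
    obtain ⟨hqu, hup⟩ := hcr
    have hlp := hsep _ hp
    have hlq := hsep _ hq
    simp only [latPt] at hlp hlq
    have hvp : α * v.1 + β * v.2 ≤ α * p.1 + β * p.2 := by
      rw [hv1', hv2']; linarith
    have hvq : α * v.1 + β * v.2 ≤ α * q.1 + β * q.2 := by
      rw [hv1', hv2']; linarith
    rcases (show q.1 ≤ p.1 by omega).eq_or_lt with hqp | hqp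
    · left
      have e1 : v.1 = q.1 := by omega
      have hp' : ((v.1 : ℝ), (p.2 : ℝ)) ∈ K := by rw [e1, hqp]; exact hp
      have hq' : ((v.1 : ℝ), (q.2 : ℝ)) ∈ K := by rw [e1]; exact hq
      exact mem_of_column hK hq' hp' (by exact_mod_cast (by omega : q.2 ≤ v.2))
        (by exact_mod_cast (by omega : v.2 ≤ p.2))
    · obtain ⟨s, hsK, hs⟩ := exists_mem_column hK hq hp
        (by simp only [latPt]; exact_mod_cast hqp) (x := v.1)
        (by simp only [latPt]; exact_mod_cast (by omega : q.1 ≤ v.1))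
        (by simp only [latPt]; exact_mod_cast (by omega : v.1 ≤ p.1))
      have hσ := hs α β _ hvq hvp
      have hlast : (∀ k ∈ K, k.1 ≤ (v.1 : ℝ)) → v.1 = p.1 ∧ v.2 < p.2 := by
        intro h
        have h1 := h _ hp
        simp only [latPt, Int.cast_le] at h1
        omega
      by_cases hvK : latPt v ∈ K
      · exact Or.inl hvK
      right
      by_cases hl : ∀ k ∈ K, k.1 ≤ (v.1 : ℝ)
      · obtain ⟨e1, e2⟩ := hlast hl
        have hpK : ((v.1 : ℝ), (p.2 : ℝ)) ∈ K := by rw [e1]; exact hp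
        have hlt : p.2 < c v.1 := by exact_mod_cast hc.lt_last v.1 p.2 hl hpK
        refine ⟨fun _ => by omega, ?_⟩
        rintro (hβ | ⟨hβ, hα⟩)
        · exfalso
          rw [e1] at hvp
          have : β * v.2 ≤ β * p.2 := by linarith
          have : (p.2 : ℝ) ≤ v.2 := (mul_le_mul_left_of_neg hβ).1 this
          have : p.2 ≤ v.2 := by exact_mod_cast this
          omega
        · exfalso
          rw [hβ] at hlp
          have : α * p.1 ≤ α * u.1 := by linarith
          have : (p.1 : ℝ) ≤ u.1 := le_of_mul_le_mul_left this hα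
          have : p.1 ≤ u.1 := by exact_mod_cast this
          omega
      · push Not at hl
        obtain ⟨k, hk, hkv⟩ := hl
        have hU1 : c v.1 ≤ v.2 → ∃ y' : ℝ, y' < v.2 ∧ ((v.1 : ℝ), y') ∈ K :=
          fun h => hc.exists_lt v.1 v.2 k.1 s h hsK ⟨k.2, hk⟩ hkv
        have hU2 : ∀ y, ((v.1 : ℝ), y) ∈ K → y < v.2 → c v.1 ≤ v.2 :=
          fun y h1 h2 => hc.le_of_lt v.1 v.2 k.1 y h1 h2 ⟨k.2, hk⟩ hkv
        constructor
        · rintro hβ hU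
          obtain ⟨y, hy, hyK⟩ := hU1 hU
          rcases hβ with hβ | ⟨hβ, hα⟩
          · have : β * v.2 ≤ β * s := by linarith
            have h2 : (v.2 : ℝ) ≤ s := le_of_mul_le_mul_left this hβ
            exact hvK (mem_of_column hK hyK hsK hy.le h2)
          · have h1 : α * q.1 ≤ α * u.1 := by rw [hβ] at hlq; linarith
            have h1 : (u.1 : ℝ) ≤ q.1 := (mul_le_mul_left_of_neg hα).1 h1
            have h1 : u.1 ≤ q.1 := by exact_mod_cast h1
            have e1 : v.1 = p.1 := by omega
            have hpK : ((v.1 : ℝ), (p.2 : ℝ)) ∈ K := by rw [e1]; exact hp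
            exact hvK (mem_of_column hK hyK hpK hy.le
              (by exact_mod_cast (by omega : v.2 ≤ p.2)))
        · rintro hβ hU
          rcases hβ with hβ | ⟨hβ, hα⟩
          · have : β * v.2 ≤ β * s := by linarith
            have h2 : s ≤ (v.2 : ℝ) := (mul_le_mul_left_of_neg hβ).1 this
            rcases h2.eq_or_lt with h3 | h3
            · apply hvK
              simp only [latPt]
              rwa [← h3]
            · exact absurd (hU2 s hsK h3) (not_le.2 hU)
          · have h1 : α * p.1 ≤ α * u.1 := by rw [hβ] at hlp; linarith
            have h1 : (p.1 : ℝ) ≤ u.1 := le_of_mul_le_mul_left h1 hα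
            have h1 : p.1 ≤ u.1 := by exact_mod_cast h1
            have e1 : v.1 = q.1 := by omega
            have hqK : ((v.1 : ℝ), (q.2 : ℝ)) ∈ K := by rw [e1]; exact hq
            rcases (show q.2 ≤ v.2 by omega).eq_or_lt with h3 | h3
            · apply hvK
              simp only [latPt]
              rwa [← h3]
            · exact absurd (hU2 _ hqK (by exact_mod_cast h3)) (not_le.2 hU)
  by_cases hβ : β > 0 ∨ β = 0 ∧ α < 0
  · left
    intro p q hp hq hcr hU
    rcases main p q hp hq hcr with h | ⟨h, -⟩
    · exact h
    · exact absurd hU (h hβ)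
  · right
    have hβ' : β < 0 ∨ β = 0 ∧ 0 < α := by
      rcases lt_trichotomy β 0 with h | h | h
      · exact Or.inl h
      · rcases lt_trichotomy α 0 with h' | h' | h'
        · exact absurd (Or.inr ⟨h, h'⟩) hβ
        · simp [h, h'] at hαβ
        · exact Or.inr ⟨h, h'⟩
      · exact absurd (Or.inl h) hβ
    intro p q hp hq hcr hU
    rcases main p q hp hq hcr with h | ⟨-, h⟩
    · exact h
    · exact absurd hU (h hβ')

theorem crosses_dichotomy_of_lt {K : Set (ℝ × ℝ)} (hK : Convex ℝ K) {c : ℤ → ℤ}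
    (hc : IsColumnCut K c) (hInn : ∀ v, latPt v ∉ Inn K) (u : ℤ × ℤ) (α β : ℝ)
    (hsep : ∀ k ∈ K, α * k.1 + β * k.2 < α * u.1 + β * u.2) :
    (∀ p q, latPt p ∈ K → latPt q ∈ K → Crosses q u p →
      ¬ c (p + q - u).1 ≤ (p + q - u).2) ∨
    (∀ p q, latPt p ∈ K → latPt q ∈ K → Crosses q u p →
      ¬ (p + q - u).2 < c (p + q - u).1) := by
  have main : ∀ p q, latPt p ∈ K → latPt q ∈ K → Crosses q u p →
      (β ≠ 0) ∧ (β > 0 → ¬ c (p + q - u).1 ≤ (p + q - u).2) ∧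
        (β < 0 → ¬ (p + q - u).2 < c (p + q - u).1) := by
    intro p q hp hq hcr
    obtain ⟨v, hv⟩ : ∃ v, v = p + q - u := ⟨_, rfl⟩
    rw [← hv]
    have hv1 : v.1 = p.1 + q.1 - u.1 := by rw [hv]; simp
    have hv2 : v.2 = p.2 + q.2 - u.2 := by rw [hv]; simp
    have hv1' : (v.1 : ℝ) = p.1 + q.1 - u.1 := by rw [hv1]; push_cast; ring
    have hv2' : (v.2 : ℝ) = p.2 + q.2 - u.2 := by rw [hv2]; push_cast; ring
    obtain ⟨hqu, hup⟩ := hcr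
    have hlp := hsep _ hp
    have hlq := hsep _ hq
    simp only [latPt] at hlp hlq
    have hvp : α * v.1 + β * v.2 < α * p.1 + β * p.2 := by
      rw [hv1', hv2']; linarith
    have hvq : α * v.1 + β * v.2 < α * q.1 + β * q.2 := by
      rw [hv1', hv2']; linarith
    have hβ0 : β ≠ 0 := by
      intro hβ
      rw [hβ] at hlp hlq
      have h1 : (u.1 : ℝ) ≤ p.1 := by exact_mod_cast (by omega : u.1 ≤ p.1)
      have h2 : (q.1 : ℝ) ≤ u.1 := by exact_mod_cast (by omega : q.1 ≤ u.1)
      rcases le_total α 0 with h | h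
      · have := mul_le_mul_of_nonpos_left h2 h
        linarith
      · have := mul_le_mul_of_nonneg_left h1 h
        linarith
    refine ⟨hβ0, ?_⟩
    rcases (show q.1 ≤ p.1 by omega).eq_or_lt with hqp | hqp
    · exfalso
      have e1 : v.1 = q.1 := by omega
      have e2 : v.1 = p.1 := by omega
      have h1 : β * v.2 < β * p.2 := by rw [e2] at hvp; linarith
      have h2 : β * v.2 < β * q.2 := by rw [e1] at hvq; linarith
      have h3 : (q.2 : ℝ) ≤ v.2 := by exact_mod_cast (by omega : q.2 ≤ v.2)
      have h4 : (v.2 : ℝ) ≤ p.2 := by exact_mod_cast (by omega : v.2 ≤ p.2)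
      rcases le_total β 0 with h | h
      · have := mul_le_mul_of_nonpos_left h4 h
        linarith
      · have := mul_le_mul_of_nonneg_left h3 h
        linarith
    · obtain ⟨s, hsK, hs⟩ := exists_mem_column hK hq hp
        (by simp only [latPt]; exact_mod_cast hqp) (x := v.1)
        (by simp only [latPt]; exact_mod_cast (by omega : q.1 ≤ v.1))
        (by simp only [latPt]; exact_mod_cast (by omega : v.1 ≤ p.1))
      have hσ : α * v.1 + β * v.2 < α * v.1 + β * s :=
        (lt_min hvq hvp).trans_le (hs α β _ (min_le_left _ _) (min_le_right _ _))
      have hσ' : β * v.2 < β * s := by linarith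
      have hlast : (∀ k ∈ K, k.1 ≤ (v.1 : ℝ)) → v.1 = p.1 ∧ v.2 < p.2 := by
        intro h
        have h1 := h _ hp
        simp only [latPt, Int.cast_le] at h1
        omega
      by_cases hl : ∀ k ∈ K, k.1 ≤ (v.1 : ℝ)
      · obtain ⟨e1, e2⟩ := hlast hl
        have hpK : ((v.1 : ℝ), (p.2 : ℝ)) ∈ K := by rw [e1]; exact hp
        have hlt : p.2 < c v.1 := by exact_mod_cast hc.lt_last v.1 p.2 hl hpK
        refine ⟨fun _ => by omega, fun hβ => ?_⟩
        exfalso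
        rw [e1] at hvp
        have : β * v.2 ≤ β * p.2 := by linarith
        have : (p.2 : ℝ) ≤ v.2 := (mul_le_mul_left_of_neg hβ).1 this
        have : p.2 ≤ v.2 := by exact_mod_cast this
        omega
      · push Not at hl
        obtain ⟨k, hk, hkv⟩ := hl
        constructor
        · intro hβ hU
          obtain ⟨y, hy, hyK⟩ := hc.exists_lt v.1 v.2 k.1 s hU hsK ⟨k.2, hk⟩ hkv
          have hvs : (v.2 : ℝ) < s := lt_of_mul_lt_mul_left hσ' hβ.le
          have hqv : (q.1 : ℝ) < v.1 := by
            have : q.1 ≠ v.1 := by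
              intro e
              rw [← e] at hvq
              have h1 : β * v.2 < β * q.2 := by linarith
              have h2 : (v.2 : ℝ) < q.2 := lt_of_mul_lt_mul_left h1 hβ.le
              have h2 : v.2 < q.2 := by exact_mod_cast h2
              omega
            exact_mod_cast (by omega : q.1 < v.1)
          refine hInn v fun a b hab => ?_
          simp only [latPt]
          rcases lt_trichotomy b 0 with hb | hb | hb
          · refine ⟨_, hyK, ?_⟩
            have := mul_lt_mul_of_neg_left hy hb
            simpa using this
          · rcases lt_trichotomy a 0 with ha | ha | ha
            · refine ⟨_, hq, ?_⟩
              have := mul_lt_mul_of_neg_left hqv ha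
              simpa [hb, latPt] using this
            · simp [ha, hb] at hab
            · refine ⟨_, hk, ?_⟩
              have := mul_lt_mul_of_pos_left hkv ha
              simpa [hb] using this
          · refine ⟨_, hsK, ?_⟩
            have := mul_lt_mul_of_pos_left hvs hb
            simpa using this
        · intro hβ hU
          have h2 : s < (v.2 : ℝ) := lt_of_mul_lt_mul_of_nonpos_left hσ' hβ.le
          exact absurd (hc.le_of_lt v.1 v.2 k.1 s hsK h2 ⟨k.2, hk⟩ hkv) (not_le.2 hU)
  rcases le_or_gt β 0 with hβ | hβ
  · right
    intro p q hp hq hcr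
    obtain ⟨h1, -, h3⟩ := main p q hp hq hcr
    exact h3 (lt_of_le_of_ne hβ h1)
  · left
    intro p q hp hq hcr
    exact (main p q hp hq hcr).2.1 hβ

namespace Ser

theorem bracket_congr {B B' : Ser} {F H : Lau} (u : ℤ × ℤ)
    (h : ∀ p ∈ F.coeff.support, ∀ q ∈ H.coeff.support, Crosses q u p ∨ Crosses p u q →
      B (-(p + q - u)) = B' (-(p + q - u))) :
    bracket B F H u = bracket B' F H u := by
  classical
  have key : ∀ B : Ser, bracket B F H u = ∑ p ∈ F.coeff.support, ∑ q ∈ H.coeff.support,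
      F.coeff p * H.coeff q * ((if u - p ∈ lexNonpos then 1 else 0) -
        (if u - q ∈ lexNonpos then 1 else 0)) * B (-(p + q - u)) := by
    intro B
    rw [bracket, sub_apply, smul_apply, smul_apply, Finsupp.sum, Finsupp.sum]
    simp only [cut_apply, smul_apply, Finsupp.sum]
    have e1 : ∀ p q : ℤ × ℤ, u - p - q = -(p + q - u) := fun p q => by abel
    have e2 : ∀ p q : ℤ × ℤ, u - q - p = -(p + q - u) := fun p q => by abel
    have : ∑ q ∈ H.coeff.support, H.coeff q * (if u - q ∈ lexNonpos then
        ∑ p ∈ F.coeff.support, F.coeff p * B (u - q - p) else 0) =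
        ∑ p ∈ F.coeff.support, ∑ q ∈ H.coeff.support, F.coeff p * H.coeff q *
          (if u - q ∈ lexNonpos then 1 else 0) * B (-(p + q - u)) := by
      rw [Finset.sum_comm]
      refine Finset.sum_congr rfl fun q _ => ?_
      split_ifs
      · rw [Finset.mul_sum]
        refine Finset.sum_congr rfl fun p _ => ?_
        rw [e2]; ring
      · simp
    rw [this, ← Finset.sum_sub_distrib]
    refine Finset.sum_congr rfl fun p _ => ?_
    have : F.coeff p * (if u - p ∈ lexNonpos then
        ∑ q ∈ H.coeff.support, H.coeff q * B (u - p - q) else 0) =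
        ∑ q ∈ H.coeff.support, F.coeff p * H.coeff q *
          (if u - p ∈ lexNonpos then 1 else 0) * B (-(p + q - u)) := by
      split_ifs
      · rw [Finset.mul_sum]
        refine Finset.sum_congr rfl fun q _ => ?_
        rw [e1]; ring
      · simp
    rw [this, ← Finset.sum_sub_distrib]
    refine Finset.sum_congr rfl fun q _ => ?_
    ring
  rw [key, key]
  refine Finset.sum_congr rfl fun p hp => Finset.sum_congr rfl fun q hq => ?_
  by_cases hcr : Crosses q u p ∨ Crosses p u q
  · rw [h p hp q hq hcr]
  · have : u - p ∈ lexNonpos ↔ u - q ∈ lexNonpos := by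
      simp only [lexNonpos, Set.mem_ofPred_eq, Prod.fst_sub, Prod.snd_sub, Crosses] at hcr ⊢
      omega
    simp [this]

/-- Restriction of a series to the region cut out by a function on columns. -/
noncomputable def colCut (c : ℤ → ℤ) : Ser →ₗ[ℂ] Ser := cut (below fun n => -c (-n))

theorem colCut_neg (c : ℤ → ℤ) (A : Ser) (v : ℤ × ℤ) :
    colCut c A (-v) = if c v.1 ≤ v.2 then A (-v) else 0 := by
  rw [colCut, cut_apply]
  simp [below]

theorem bracket_colCut_eq_zero {A : Ser} {F H : Lau} (hF : F • A = 0) (hH : H • A = 0) {c : ℤ → ℤ}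
    {u : ℤ × ℤ}
    (h : (∀ p q, (p ∈ F.coeff.support ∧ q ∈ H.coeff.support ∨ q ∈ F.coeff.support ∧
        p ∈ H.coeff.support) → Crosses q u p → c (p + q - u).1 ≤ (p + q - u).2 →
          A (-(p + q - u)) = 0) ∨
      (∀ p q, (p ∈ F.coeff.support ∧ q ∈ H.coeff.support ∨ q ∈ F.coeff.support ∧
        p ∈ H.coeff.support) → Crosses q u p → (p + q - u).2 < c (p + q - u).1 →
          A (-(p + q - u)) = 0)) :
    bracket (colCut c A) F H u = 0 := by
  rcases h with h | h
  · have : bracket (0 : Ser) F H u = 0 := by simp [bracket]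
    rw [← this]
    refine bracket_congr u fun p hp q hq hcr => ?_
    rw [colCut_neg, zero_apply]
    split_ifs with hU
    · rcases hcr with hcr | hcr
      · exact h p q (Or.inl ⟨hp, hq⟩) hcr hU
      · rw [add_comm p q] at *
        exact h q p (Or.inr ⟨hp, hq⟩) hcr hU
    · rfl
  · have : bracket A F H u = 0 := by simp [bracket, hF, hH]
    rw [← this]
    refine bracket_congr u fun p hp q hq hcr => ?_
    rw [colCut_neg]
    split_ifs with hU
    · rfl
    · symm
      rw [not_le] at hU
      rcases hcr with hcr | hcr
      · exact h p q (Or.inl ⟨hp, hq⟩) hcr hU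
      · rw [add_comm p q] at *
        exact h q p (Or.inr ⟨hp, hq⟩) hcr hU

theorem bracket_colCut_support_inn {K : Set (ℝ × ℝ)} (hK : Convex ℝ K) {c : ℤ → ℤ}
    (hc : IsColumnCut K c) {A : Ser} {F H : Lau} (hF : F • A = 0) (hH : H • A = 0)
    (hFK : ∀ p ∈ F.coeff.support, latPt p ∈ K) (hHK : ∀ p ∈ H.coeff.support, latPt p ∈ K)
    (hA : ∀ v, latPt v ∈ K → A (-v) = 0) {u : ℤ × ℤ} (hu : bracket (colCut c A) F H u ≠ 0) :
    latPt u ∈ Inn K := by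
  by_contra hI
  simp only [Inn, Set.mem_ofPred_eq, not_forall, not_exists, not_and, not_lt] at hI
  obtain ⟨α, β, hαβ, hsep⟩ := hI
  apply hu
  apply bracket_colCut_eq_zero hF hH
  refine (crosses_dichotomy_of_le hK hc u α β hαβ hsep).imp ?_ ?_
  all_goals
    rintro h p q hpq hcr hU
    refine hA _ (h p q ?_ ?_ hcr hU)
    · rcases hpq with h | h
      · exact hFK _ h.1
      · exact hHK _ h.2
    · rcases hpq with h | h
      · exact hHK _ h.2
      · exact hFK _ h.1

theorem bracket_colCut_support_subset {K : Set (ℝ × ℝ)} (hK : Convex ℝ K) (hKc : IsClosed K)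
    {c : ℤ → ℤ}
    (hc : IsColumnCut K c) (hInn : ∀ v, latPt v ∉ Inn K) {A : Ser} {F H : Lau} (hF : F • A = 0)
    (hH : H • A = 0) (hFK : ∀ p ∈ F.coeff.support, latPt p ∈ K)
    (hHK : ∀ p ∈ H.coeff.support, latPt p ∈ K) {u : ℤ × ℤ}
    (hu : bracket (colCut c A) F H u ≠ 0) : latPt u ∈ K := by
  by_contra hI
  obtain ⟨f, s, hfs, hsu⟩ := geometric_hahn_banach_closed_point hK hKc hI
  have hf : ∀ x : ℝ × ℝ, f x = f (1, 0) * x.1 + f (0, 1) * x.2 := by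
    intro x
    have : x = x.1 • ((1, 0) : ℝ × ℝ) + x.2 • ((0, 1) : ℝ × ℝ) := by ext <;> simp
    conv_lhs => rw [this]
    rw [map_add, map_smul, map_smul, smul_eq_mul, smul_eq_mul]
    ring
  apply hu
  apply bracket_colCut_eq_zero hF hH
  have hsep : ∀ k ∈ K, f (1, 0) * k.1 + f (0, 1) * k.2 < f (1, 0) * u.1 + f (0, 1) * u.2 := by
    intro k hk
    have := (hfs k hk).trans hsu
    rwa [hf k, hf (latPt u)] at this
  refine (crosses_dichotomy_of_lt hK hc hInn u _ _ hsep).imp ?_ ?_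
  all_goals
    rintro h p q hpq hcr hU
    refine absurd hU (h p q ?_ ?_ hcr)
    · rcases hpq with h | h
      · exact hFK _ h.1
      · exact hHK _ h.2
    · rcases hpq with h | h
      · exact hHK _ h.2
      · exact hFK _ h.1

end Ser

/-- Laurent polynomials with exponents in `S`. -/
def lauOn (S : Set (ℤ × ℤ)) : Submodule ℂ Lau where
  carrier := {F | ∀ p, F.coeff p ≠ 0 → p ∈ S}
  zero_mem' := by intro p hp; simp at hp
  add_mem' := by
    intro F G hF hG p hp
    by_contra h
    apply hp
    rw [AddMonoidAlgebra.coeff_add, Finsupp.add_apply, not_not.1 (mt (hF p) h),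
      not_not.1 (mt (hG p) h), add_zero]
  smul_mem' := by
    intro c F hF p hp
    by_contra h
    apply hp
    rw [AddMonoidAlgebra.coeff_smul, Finsupp.smul_apply, not_not.1 (mt (hF p) h), smul_zero]

/-- The coefficients identify `lauOn S` with functions on the finite set `S`. -/
noncomputable def lauOnEquiv (S : Finset (ℤ × ℤ)) : lauOn (S : Set (ℤ × ℤ)) ≃ₗ[ℂ] (S → ℂ) where
  toFun F p := F.1.coeff p
  map_add' F G := by ext p; simp
  map_smul' c F := by ext p; simp
  invFun a := ⟨∑ p : S, AddMonoidAlgebra.single p.1 (a p), by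
    refine Submodule.sum_mem _ fun p _ => ?_
    intro q hq
    rw [AddMonoidAlgebra.coeff_single, Finsupp.single_apply] at hq
    have : p.1 = q := by by_contra h; simp [h] at hq
    rw [← this]
    exact p.2⟩
  left_inv F := by
    apply Subtype.ext
    apply AddMonoidAlgebra.coeff_injective
    ext q
    simp only [AddMonoidAlgebra.coeff_sum, Finsupp.finsetSum_apply, AddMonoidAlgebra.coeff_single,
      Finsupp.single_apply]
    by_cases hq : q ∈ S
    · rw [Finset.sum_eq_single ⟨q, hq⟩]
      · simp
      · intro b _ hb
        rw [if_neg]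
        intro h
        exact hb (Subtype.ext h)
      · simp
    · rw [Finset.sum_eq_zero]
      · by_contra h
        exact hq (F.2 q (Ne.symm h))
      · intro b _
        rw [if_neg]
        rintro rfl
        exact hq b.2
  right_inv a := by
    ext q
    simp only [AddMonoidAlgebra.coeff_sum, Finsupp.finsetSum_apply, AddMonoidAlgebra.coeff_single,
      Finsupp.single_apply]
    rw [Finset.sum_eq_single q]
    · simp
    · intro b _ hb
      rw [if_neg]
      intro h
      exact hb (Subtype.ext h)
    · simp

instance (S : Finset (ℤ × ℤ)) : FiniteDimensional ℂ (lauOn (S : Set (ℤ × ℤ))) :=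
  (lauOnEquiv S).symm.finiteDimensional

theorem finrank_lauOn (S : Finset (ℤ × ℤ)) :
    Module.finrank ℂ (lauOn (S : Set (ℤ × ℤ))) = S.card := by
  rw [(lauOnEquiv S).finrank_eq, Module.finrank_fintype_fun_eq_card, Fintype.card_coe]

theorem finite_preimage_latPt {K : Set (ℝ × ℝ)} (hK : Bornology.IsBounded K) :
    (latPt ⁻¹' K).Finite := by
  obtain ⟨M, hM⟩ := hK.exists_norm_le
  refine ((Set.finite_Icc (-⌈M⌉) ⌈M⌉).prod (Set.finite_Icc (-⌈M⌉) ⌈M⌉)).subset ?_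
  intro p hp
  have h := hM _ hp
  have hM' := Int.le_ceil M
  have h1 : |(p.1 : ℝ)| ≤ ⌈M⌉ := ((norm_fst_le (latPt p)).trans h).trans hM'
  have h2 : |(p.2 : ℝ)| ≤ ⌈M⌉ := ((norm_snd_le (latPt p)).trans h).trans hM'
  rw [← Int.cast_abs, Int.cast_le, abs_le] at h1 h2
  exact ⟨h1, h2⟩

namespace Ser

/-- The part of a series with exponents in the finite set `D`. -/
noncomputable def truncate (D : Finset (ℤ × ℤ)) : Ser →ₗ[ℂ] lauOn (D : Set (ℤ × ℤ)) :=
  (lauOnEquiv D).symm.toLinearMap ∘ₗ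
    { toFun s p := s p
      map_add' _ _ := rfl
      map_smul' _ _ := rfl }

theorem ofLau_truncate (D : Finset (ℤ × ℤ)) (s : Ser) (h : ∀ r, s r ≠ 0 → r ∈ D) :
    ofLau (truncate D s) = s := by
  have h1 : lauOnEquiv D (truncate D s) = fun p : D => s p.1 :=
    (lauOnEquiv D).apply_symm_apply _
  ext r
  rw [ofLau_apply]
  by_cases hr : r ∈ D
  · exact congrFun h1 ⟨r, hr⟩
  · rw [not_not.1 (mt (h r) hr)]
    by_contra h2
    exact hr ((truncate D s).2 r h2)

/-- The bracket with a fixed second argument, as a linear map. -/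
noncomputable def bracketL (B : Ser) (H : Lau) : Lau →ₗ[ℂ] Ser where
  toFun F := bracket B F H
  map_add' F F' := bracket_add_left B F F' H
  map_smul' c F := bracket_smul_left B c F H

theorem cut_below_sub_mem (c c' : ℤ → ℤ) (s : Ser) :
    cut (below c) s - cut (below c') s ∈ colFinite := by
  intro n
  refine (Set.finite_Icc (min (c n) (c' n)) (max (c n) (c' n))).subset fun m hm => ?_
  by_contra hc
  apply hm
  rw [Set.mem_Icc] at hc
  rw [sub_apply, cut_apply, cut_apply]
  have : ((n, m) : ℤ × ℤ) ∈ below c ↔ (n, m) ∈ below c' := by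
    simp only [below, Set.mem_ofPred_eq]
    omega
  by_cases h : ((n, m) : ℤ × ℤ) ∈ below c
  · rw [if_pos h, if_pos (this.1 h), sub_self]
  · rw [if_neg h, if_neg (mt this.2 h), sub_self]

theorem exists_mul_bracket_eq {B : Ser} {f P ω ζ : Lau} (hf : f • B ∈ colFinite)
    (hP : P • B ∈ colFinite) (hζ : ζ • B ∈ colFinite) (h : bracket B f P = ofLau ω) :
    ∃ α β : Lau, ζ * ω = α * P + β * f := by
  obtain ⟨C₁, h₁⟩ := exists_cut_smul _ hP ζ
  obtain ⟨C₂, h₂⟩ := exists_cut_smul _ hζ P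
  obtain ⟨C₃, h₃⟩ := exists_cut_smul _ hf ζ
  obtain ⟨C₄, h₄⟩ := exists_cut_smul _ hζ f
  rw [smul_comm, h₂] at h₁
  rw [smul_comm, h₄] at h₃
  refine ⟨C₃ - C₄, C₂ - C₁, ofLau_injective ?_⟩
  rw [← smul_eq_mul, ofLau.map_smul, ← h, bracket, smul_sub, smul_comm ζ f, smul_comm ζ P,
    eq_sub_of_add_eq h₁.symm, eq_sub_of_add_eq h₃.symm, map_add, mul_comm, mul_comm _ f,
    ← smul_eq_mul, ← smul_eq_mul, ofLau.map_smul, ofLau.map_smul, map_sub, map_sub]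
  module

theorem ev_bracket_eq_zero {B : Ser} {f P ω : Lau} (t : ℂˣ × ℂˣ) (hf : f • B ∈ colFinite)
    (hP : P • B ∈ colFinite) (hX : zetaX t • B ∈ colFinite) (hY : zetaY t • B ∈ colFinite)
    (h : bracket B f P = ofLau ω) (hPt : ev t P = 0) (hft : ev t f = 0)
    (hdP : ∀ w, dEv t w P = 0) : ev t ω = 0 := by
  obtain ⟨α, β, h1⟩ := exists_mul_bracket_eq hf hP hX h
  obtain ⟨α', β', h2⟩ := exists_mul_bracket_eq hf hP hY h
  let fst : ℤ × ℤ →+ ℂ := (Int.castAddHom ℂ).comp (AddMonoidHom.fst ℤ ℤ)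
  let snd : ℤ × ℤ →+ ℂ := (Int.castAddHom ℂ).comp (AddMonoidHom.snd ℤ ℤ)
  have a1 := congrArg (dEv t fst) h1
  have a3 := congrArg (dEv t fst) h2
  have a4 := congrArg (dEv t snd) h2
  rw [map_add, dEv_mul, dEv_mul, dEv_mul, ev_zetaX, dEv_zetaX, hPt, hft, hdP] at a1
  rw [map_add, dEv_mul, dEv_mul, dEv_mul, ev_zetaY, dEv_zetaY, hPt, hft, hdP] at a3 a4
  simp only [sub_self, zero_mul, mul_zero, zero_add, add_zero] at a1 a3 a4
  have b1 : fst (1, 0) = 1 := by simp [fst]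
  have b2 : fst (0, 1) = 0 := by simp [fst]
  have b3 : snd (0, 1) = 1 := by simp [snd]
  rw [b1, one_mul] at a1
  rw [b2, zero_mul, zero_mul] at a3
  rw [b3, one_mul] at a4
  by_contra hω
  have h3 : dEv t fst f ≠ 0 := by
    intro h0
    rw [h0, mul_zero] at a1
    exact mul_ne_zero (Units.ne_zero _) hω a1
  have h4 : ev t β' = 0 := (mul_eq_zero.1 a3.symm).resolve_right h3
  rw [h4, zero_mul] at a4
  exact mul_ne_zero (Units.ne_zero _) hω a4

theorem exists_latPt_mem_inn {P : Lau} (hP : Prime P) {K : Set (ℝ × ℝ)} (hKconv : Convex ℝ K)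
    (hKc : IsClosed K) (hKb : Bornology.IsBounded K) (hPK : ∀ p, P.coeff p ≠ 0 → latPt p ∈ K)
    (t : ℂˣ × ℂˣ) (hPt : ev t P = 0) (hdP : ∀ w, dEv t w P = 0)
    (hnode : ∃ f : Lau, (∀ p, f.coeff p ≠ 0 → latPt p ∈ K) ∧ ev t f = 0 ∧ ∃ w, dEv t w f ≠ 0) :
    ∃ o, latPt o ∈ Inn K := by
  by_contra hInn
  push Not at hInn
  obtain ⟨M, hM⟩ := hKb.exists_norm_le
  obtain ⟨c, hc⟩ := exists_isColumnCut K (M + 1) fun k hk =>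
    (((norm_snd_le k).trans (hM k hk)).trans_lt (lt_add_one M))
  set S := (finite_preimage_latPt hKb).toFinset with hS
  have hmemS : ∀ p, p ∈ S ↔ latPt p ∈ K := fun p => by simp [hS]
  set X : Submodule ℂ Lau := lauOn (S : Set (ℤ × ℤ)) ⊓ LinearMap.ker (ev t).toLinearMap with hX
  have hXS : X ≤ lauOn (S : Set (ℤ × ℤ)) := inf_le_left
  have : FiniteDimensional ℂ X := Submodule.finiteDimensional_of_le hXS
  set B := colCut c (delta t) with hB
  have hann : ∀ F : Lau, ev t F = 0 → F • delta t = 0 := fun F hF => by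
    rw [smul_delta, hF, zero_smul]
  have hcol : ∀ F : Lau, ev t F = 0 → F • B ∈ colFinite := fun F hF =>
    smul_cut_below_mem _ (hann F hF)
  have hPS : P ∈ X := ⟨fun p hp => (hmemS p).2 (hPK p hp), hPt⟩
  have hof : ∀ f ∈ X, ofLau (truncate S (bracket B f P)) = bracket B f P := by
    intro f hf
    refine ofLau_truncate _ _ fun r hr => (hmemS r).2 ?_
    refine bracket_colCut_support_subset hKconv hKc hc hInn (hann f hf.2) (hann P hPt) ?_ ?_ hr
    · intro p hp
      exact (hmemS p).1 (hf.1 p (Finsupp.mem_support_iff.1 hp))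
    · intro p hp
      exact hPK p (Finsupp.mem_support_iff.1 hp)
  have hmaps : ∀ f ∈ X, ((lauOn (S : Set (ℤ × ℤ))).subtype ∘ₗ truncate S ∘ₗ bracketL B P) f ∈ X := by
    intro f hf
    refine ⟨(truncate S (bracket B f P)).2, ?_⟩
    exact ev_bracket_eq_zero t (hcol f hf.2) (hcol P hPt) (hcol _ (by rw [ev_zetaX, sub_self]))
      (hcol _ (by rw [ev_zetaY, sub_self])) (hof f hf).symm hPt hf.2 hdP
  set T : Module.End ℂ X := LinearMap.restrict _ hmaps with hT
  have hTof : ∀ f : X, ofLau (T f) = bracket B f P := fun f => hof f f.2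
  set X₀ : Submodule ℂ X := ((Ideal.span {P}).restrictScalars ℂ).comap X.subtype with hX₀
  have hmem₀ : ∀ f : X, f ∈ X₀ ↔ P ∣ (f : Lau) := by
    intro f
    simp [hX₀, Ideal.mem_span_singleton]
  have hinv : X₀ ≤ X₀.comap T := by
    intro f hf
    rw [hmem₀] at hf
    rw [Submodule.mem_comap, hmem₀]
    obtain ⟨g, hg⟩ := hf
    obtain ⟨κ, hκ⟩ := exists_bracket_mul_right (hcol P hPt) g
    refine ⟨-κ, ofLau_injective ?_⟩
    rw [hTof, hg, bracket_swap, hκ P, bracket_self, smul_zero, zero_add, ← map_neg, mul_neg]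
  have hnt : Nontrivial (X ⧸ X₀) := by
    rw [Submodule.Quotient.nontrivial_iff]
    obtain ⟨f, hfK, hft, w, hw⟩ := hnode
    intro htop
    have hfX : f ∈ X := ⟨fun p hp => (hmemS p).2 (hfK p hp), hft⟩
    have : (⟨f, hfX⟩ : X) ∈ X₀ := by rw [htop]; trivial
    rw [hmem₀] at this
    obtain ⟨g, hg⟩ := this
    apply hw
    simp only at hg
    rw [hg, dEv_mul, hPt, hdP]
    simp
  obtain ⟨μ, hμ⟩ := Module.End.exists_eigenvalue (X₀.mapQ X₀ T hinv)
  obtain ⟨x, hx⟩ := hμ.exists_hasEigenvector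
  obtain ⟨f, rfl⟩ := X₀.mkQ_surjective x
  have hfX₀ : f ∉ X₀ := by
    intro h
    apply hx.2
    simpa using h
  have h1 : T f - μ • f ∈ X₀ := by
    rw [← Submodule.Quotient.mk_eq_zero, Submodule.Quotient.mk_sub, sub_eq_zero]
    have := hx.apply_eq_smul
    rw [Submodule.mkQ_apply, Submodule.mapQ_apply] at this
    exact this
  rw [hmem₀] at h1 hfX₀
  obtain ⟨g, hg⟩ := h1
  refine bracket_ne_of_smul_sub_mem hP hfX₀ t hPt f.2.2 (hcol P hPt) (hcol _ f.2.2) 1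
    one_ne_zero ?_ g (algebraMap ℂ Lau μ) ?_
  · rw [one_smul, one_smul, hB]
    exact cut_below_sub_mem _ _ _
  · rw [← hTof]
    congr 1
    rw [Submodule.coe_sub, Submodule.coe_smul, Algebra.smul_def] at hg
    linear_combination hg

end Ser

theorem coeff_mul_of_isMax {Γ : Type*} [AddCommGroup Γ] [LinearOrder Γ] [IsOrderedAddMonoid Γ]
    (κ : ℤ × ℤ →+ Γ) (hκ : Function.Injective κ) {F G : Lau} {a b : ℤ × ℤ}
    (ha : ∀ p, F.coeff p ≠ 0 → κ p ≤ κ a) (hb : ∀ q, G.coeff q ≠ 0 → κ q ≤ κ b) :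
    (F * G).coeff (a + b) = F.coeff a * G.coeff b := by
  apply AddMonoidAlgebra.coeff_mul_add_of_uniqueAdd
  intro p q hp hq hpq
  have hp' := ha p (Finsupp.mem_support_iff.1 hp)
  have hq' := hb q (Finsupp.mem_support_iff.1 hq)
  have h := congrArg κ hpq
  rw [map_add, map_add] at h
  rcases hp'.lt_or_eq with h1 | h1
  · exact absurd h (add_lt_add_of_lt_of_le h1 hq').ne
  · rw [h1] at h
    exact ⟨hκ h1, hκ (add_left_cancel h)⟩

theorem exists_isMax_support {Γ : Type*} [AddCommGroup Γ] [LinearOrder Γ]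
    (κ : ℤ × ℤ →+ Γ) {F : Lau} (hF : F ≠ 0) :
    ∃ a, F.coeff a ≠ 0 ∧ ∀ p, F.coeff p ≠ 0 → κ p ≤ κ a := by
  have : F.coeff.support.Nonempty := by
    rw [Finsupp.support_nonempty_iff]
    intro h
    exact hF (AddMonoidAlgebra.coeff_injective h)
  obtain ⟨a, ha, h⟩ := Finset.exists_max_image _ κ this
  exact ⟨a, Finsupp.mem_support_iff.1 ha, fun p hp => h p (Finsupp.mem_support_iff.2 hp)⟩

/-- The lexicographic order on the lattice. -/
def lexHom : ℤ × ℤ →+ Lex (ℤ × ℤ) where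
  toFun := toLex
  map_zero' := rfl
  map_add' _ _ := rfl

theorem lexHom_injective : Function.Injective lexHom := toLex.injective

/-- The order refining a linear functional by the lexicographic order. -/
def functionalLexHom (α β : ℝ) : ℤ × ℤ →+ Lex (ℝ × Lex (ℤ × ℤ)) where
  toFun p := toLex (α * p.1 + β * p.2, toLex p)
  map_zero' := by
    simp only [Prod.fst_zero, Prod.snd_zero, Int.cast_zero, mul_zero, add_zero]
    rfl
  map_add' p q := by
    have : α * ((p + q).1 : ℤ) + β * ((p + q).2 : ℤ) =
        (α * p.1 + β * p.2) + (α * q.1 + β * q.2) := by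
      simp only [Prod.fst_add, Prod.snd_add, Int.cast_add]; ring
    rw [this]
    rfl

theorem functionalLexHom_injective (α β : ℝ) : Function.Injective (functionalLexHom α β) := by
  intro p q h
  exact toLex.injective (congrArg (fun x => (ofLex x).2) h)

theorem le_of_functionalLexHom_le {α β : ℝ} {p q : ℤ × ℤ}
    (h : functionalLexHom α β p ≤ functionalLexHom α β q) :
    α * p.1 + β * p.2 ≤ α * q.1 + β * q.2 := by
  have := Prod.Lex.monotone_fst _ _ h
  exact this

/-- The leading exponents of the nonzero elements of a space of Laurent polynomials. -/
def leads (W : Submodule ℂ Lau) : Set (ℤ × ℤ) :=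
  {a | ∃ F ∈ W, F.coeff a ≠ 0 ∧ ∀ p, F.coeff p ≠ 0 → lexHom p ≤ lexHom a}

theorem finrank_le_card_leads {W : Submodule ℂ Lau} {Λ : Finset (ℤ × ℤ)}
    (h : leads W = Λ) : Module.finrank ℂ W ≤ Λ.card := by
  let f : W →ₗ[ℂ] (Λ → ℂ) :=
    { toFun F p := F.1.coeff p
      map_add' F G := by ext p; simp
      map_smul' c F := by ext p; simp }
  have hf : Function.Injective f := by
    rw [injective_iff_map_eq_zero]
    intro F hF
    by_contra hne
    obtain ⟨a, ha, hmax⟩ := exists_isMax_support lexHom (F := F.1) (fun h0 => hne (Subtype.ext h0))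
    have haΛ : a ∈ (Λ : Set (ℤ × ℤ)) := h ▸ ⟨F.1, F.2, ha, hmax⟩
    exact ha (congrFun hF ⟨a, haΛ⟩)
  have := LinearMap.finrank_le_finrank_of_injective hf
  rwa [Module.finrank_fintype_fun_eq_card, Fintype.card_coe] at this

theorem exists_finset_leads {W : Submodule ℂ Lau} {S : Finset (ℤ × ℤ)}
    (h : W ≤ lauOn (S : Set (ℤ × ℤ))) : ∃ Λ : Finset (ℤ × ℤ), leads W = Λ := by
  have : (leads W).Finite := by
    refine S.finite_toSet.subset ?_
    rintro a ⟨F, hF, ha, -⟩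
    exact h hF a ha
  exact ⟨this.toFinset, this.coe_toFinset.symm⟩

theorem leads_nonempty {W : Submodule ℂ Lau} (h : W ≠ ⊥) : (leads W).Nonempty := by
  obtain ⟨F, hF, hne⟩ := (Submodule.ne_bot_iff W).1 h
  obtain ⟨a, ha⟩ := exists_isMax_support lexHom hne
  exact ⟨a, F, hF, ha⟩

open scoped Pointwise in
/-- A Hopf-type inequality for spaces of Laurent polynomials. -/
theorem finrank_add_finrank_le {G I : Submodule ℂ Lau} {D S S' : Finset (ℤ × ℤ)}
    (hG : G ≤ lauOn (S : Set (ℤ × ℤ))) (hI : I ≤ lauOn (S' : Set (ℤ × ℤ))) (hG0 : G ≠ ⊥)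
    (hI0 : I ≠ ⊥) (h : ∀ g ∈ G, ∀ i ∈ I, g * i ∈ lauOn (D : Set (ℤ × ℤ))) :
    Module.finrank ℂ G + Module.finrank ℂ I ≤ D.card + 1 := by
  classical
  obtain ⟨Λ, hΛ⟩ := exists_finset_leads hG
  obtain ⟨Λ', hΛ'⟩ := exists_finset_leads hI
  have h1 := finrank_le_card_leads hΛ
  have h2 := finrank_le_card_leads hΛ'
  have hne : Λ.Nonempty := by rw [← Finset.coe_nonempty, ← hΛ]; exact leads_nonempty hG0
  have hne' : Λ'.Nonempty := by rw [← Finset.coe_nonempty, ← hΛ']; exact leads_nonempty hI0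
  have h3 := cauchy_davenport_add_of_linearOrder_isCancelAdd (hne.image lexHom)
    (hne'.image lexHom)
  rw [Finset.card_image_of_injective _ lexHom_injective,
    Finset.card_image_of_injective _ lexHom_injective] at h3
  have h4 : (Λ.image lexHom + Λ'.image lexHom).card ≤ D.card := by
    rw [← Finset.card_image_of_injective D lexHom_injective]
    apply Finset.card_le_card
    intro x hx
    obtain ⟨y, hy, z, hz, rfl⟩ := Finset.mem_add.1 hx
    obtain ⟨a, ha, rfl⟩ := Finset.mem_image.1 hy
    obtain ⟨b, hb, rfl⟩ := Finset.mem_image.1 hz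
    rw [← map_add]
    apply Finset.mem_image_of_mem
    rw [← Finset.mem_coe, ← hΛ] at ha
    rw [← Finset.mem_coe, ← hΛ'] at hb
    obtain ⟨F, hF, ha1, ha2⟩ := ha
    obtain ⟨F', hF', hb1, hb2⟩ := hb
    apply h F hF F' hF'
    rw [coeff_mul_of_isMax lexHom lexHom_injective ha2 hb2]
    exact mul_ne_zero ha1 hb1
  omega

theorem add_mem_inn_of_mul_mem {P g : Lau} {K : Set (ℝ × ℝ)} (hP0 : P ≠ 0)
    (hPg : ∀ p, (P * g).coeff p ≠ 0 → latPt p ∈ K) {o s : ℤ × ℤ}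
    (ho : latPt o ∈ Inn (convexHull ℝ (latPt '' {p | P.coeff p ≠ 0})))
    (hs : g.coeff s ≠ 0) : latPt (s + o) ∈ Inn K := by
  intro α β hαβ
  obtain ⟨p, hp, hpo⟩ : ∃ p, P.coeff p ≠ 0 ∧ α * o.1 + β * o.2 < α * p.1 + β * p.2 := by
    by_contra hc
    push Not at hc
    obtain ⟨k, hk, hlt⟩ := ho α β hαβ
    have hconv : Convex ℝ {k : ℝ × ℝ | α * k.1 + β * k.2 ≤ α * o.1 + β * o.2} := by
      apply convex_halfSpace_le
      constructor
      · intro x y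
        simp only [Prod.fst_add, Prod.snd_add]; ring
      · intro c x
        simp only [Prod.smul_fst, Prod.smul_snd, smul_eq_mul]; ring
    have := convexHull_min (s := latPt '' {p | P.coeff p ≠ 0}) (by
      rintro _ ⟨p, hp, rfl⟩
      exact hc p hp) hconv hk
    exact absurd hlt (not_lt.2 this)
  have hg0 : g ≠ 0 := by rintro rfl; simp at hs
  obtain ⟨a, ha, hamax⟩ := exists_isMax_support (functionalLexHom α β) hP0
  obtain ⟨b, hb, hbmax⟩ := exists_isMax_support (functionalLexHom α β) hg0
  refine ⟨latPt (a + b), hPg _ ?_, ?_⟩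
  · rw [coeff_mul_of_isMax _ (functionalLexHom_injective α β) hamax hbmax]
    exact mul_ne_zero ha hb
  · have h1 := le_of_functionalLexHom_le (hamax p hp)
    have h2 := le_of_functionalLexHom_le (hbmax s hs)
    simp only [latPt, Prod.fst_add, Prod.snd_add, Int.cast_add]
    linarith

section

open Ser

theorem exists_ev_ne_zero {s t : ℂˣ × ℂˣ} (h : s ≠ t) : ∃ ξ : Lau, ev s ξ = 0 ∧ ev t ξ ≠ 0 := by
  by_cases h1 : s.1 = t.1
  · refine ⟨zetaY s, by rw [ev_zetaY, sub_self], ?_⟩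
    rw [ev_zetaY, sub_ne_zero]
    exact fun h2 => h (Prod.ext h1 (Units.ext h2.symm))
  · refine ⟨zetaX s, by rw [ev_zetaX, sub_self], ?_⟩
    rw [ev_zetaX, sub_ne_zero]
    exact fun h2 => h1 (Units.ext h2.symm)

theorem hom_apply_eq (w : ℤ × ℤ →+ ℂ) (p : ℤ × ℤ) :
    w p = p.1 * w (1, 0) + p.2 * w (0, 1) := by
  have : p = p.1 • ((1, 0) : ℤ × ℤ) + p.2 • ((0, 1) : ℤ × ℤ) := by
    ext <;> simp
  conv_lhs => rw [this]
  rw [map_add, map_zsmul, map_zsmul, zsmul_eq_mul, zsmul_eq_mul]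

theorem smul_sum_moment {N : ℕ} (t : Fin N → ℂˣ × ℂˣ) (w₀ : Fin N → ℂ) (w : Fin N → (ℤ × ℤ →+ ℂ))
    (F : Lau) :
    F • ∑ h, (w₀ h • delta (t h) + moment (t h) (w h)) =
      ∑ h, ((w₀ h * ev (t h) F + dEv (t h) (w h) F) • delta (t h) +
        ev (t h) F • moment (t h) (w h)) := by
  rw [Finset.smul_sum]
  refine Finset.sum_congr rfl fun h _ => ?_
  rw [smul_add, smul_comm', smul_delta, smul_moment]
  module

theorem exists_smul_eq_delta {N : ℕ} {t : Fin N → ℂˣ × ℂˣ} (ht : Function.Injective t)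
    (w₀ : Fin N → ℂ) (w : Fin N → (ℤ × ℤ →+ ℂ)) (h₀ : Fin N)
    (hw : w₀ h₀ ≠ 0 ∨ w h₀ (1, 0) ≠ 0 ∨ w h₀ (0, 1) ≠ 0) :
    ∃ (g : Lau) (c : ℂ), c ≠ 0 ∧
      g • ∑ h, (w₀ h • delta (t h) + moment (t h) (w h)) = c • delta (t h₀) := by
  have : ∀ s : Fin N, ∃ ξ : Lau, s ≠ h₀ → ev (t s) ξ = 0 ∧ ev (t h₀) ξ ≠ 0 := by
    intro s
    by_cases hs : s = h₀
    · exact ⟨0, fun h => absurd hs h⟩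
    · obtain ⟨ξ, hξ⟩ := exists_ev_ne_zero (ht.ne hs)
      exact ⟨ξ, fun _ => hξ⟩
  choose ξ hξ using this
  set e : Lau := ∏ s ∈ Finset.univ.erase h₀, ξ s ^ 2 with he
  have he0 : ev (t h₀) e ≠ 0 := by
    rw [he, map_prod]
    refine Finset.prod_ne_zero_iff.2 fun s hs => ?_
    rw [map_pow]
    exact pow_ne_zero 2 (hξ s (Finset.ne_of_mem_erase hs)).2
  have hes : ∀ s, s ≠ h₀ → ∀ x : Lau, ev (t s) (x * e) = 0 ∧ dEv (t s) (w s) (x * e) = 0 := by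
    intro s hs x
    have h1 : x * e = ξ s * (ξ s * (x * ∏ s ∈ (Finset.univ.erase h₀).erase s, ξ s ^ 2)) := by
      rw [he, ← Finset.mul_prod_erase (Finset.univ.erase h₀) (fun s => ξ s ^ 2)
        (Finset.mem_erase.2 ⟨hs, Finset.mem_univ s⟩)]
      ring
    rw [h1]
    refine ⟨by rw [map_mul, (hξ s hs).1, zero_mul], ?_⟩
    rw [dEv_mul, map_mul (ev (t s)), (hξ s hs).1, zero_mul, zero_mul, mul_zero, zero_add]
  have key : ∀ x : Lau, (x * e) • ∑ h, (w₀ h • delta (t h) + moment (t h) (w h)) =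
      (w₀ h₀ * ev (t h₀) (x * e) + dEv (t h₀) (w h₀) (x * e)) • delta (t h₀) +
        ev (t h₀) (x * e) • moment (t h₀) (w h₀) := by
    intro x
    rw [smul_sum_moment]
    refine Finset.sum_eq_single h₀ (fun s _ hs => ?_) (fun h => absurd (Finset.mem_univ _) h)
    rw [(hes s hs x).1, (hes s hs x).2]
    simp
  have hζ : ∀ x : Lau, ev (t h₀) x = 0 → dEv (t h₀) (w h₀) x ≠ 0 → ∃ (g : Lau) (c : ℂ), c ≠ 0 ∧
      g • ∑ h, (w₀ h • delta (t h) + moment (t h) (w h)) = c • delta (t h₀) := by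
    intro x hx hdx
    refine ⟨x * e, dEv (t h₀) (w h₀) x * ev (t h₀) e, mul_ne_zero hdx he0, ?_⟩
    rw [key, dEv_mul, map_mul, hx]
    simp
  by_cases h1 : w h₀ (1, 0) = 0
  · by_cases h2 : w h₀ (0, 1) = 0
    · have hw0 : w h₀ = 0 := by
        ext p
        rw [hom_apply_eq, h1, h2]
        simp
      refine ⟨1 * e, w₀ h₀ * ev (t h₀) e, mul_ne_zero (by tauto) he0, ?_⟩
      have hm : moment (t h₀) 0 = 0 := by
        ext r
        rw [moment_apply]
        simp
      rw [key, hw0, one_mul, hm, dEv_apply, hm]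
      simp
    · apply hζ (zetaY (t h₀))
      · rw [ev_zetaY, sub_self]
      · rw [dEv_zetaY]
        exact mul_ne_zero h2 (Units.ne_zero _)
  · apply hζ (zetaX (t h₀))
    · rw [ev_zetaX, sub_self]
    · rw [dEv_zetaX]
      exact mul_ne_zero h1 (Units.ne_zero _)

/-- The conditions defining the Laurent polynomials annihilating the series attached to `w`. -/
noncomputable def jetMap {N : ℕ} (t : Fin N → ℂˣ × ℂˣ) (w : Fin N → (ℤ × ℤ →+ ℂ)) :
    Lau →ₗ[ℂ] (Fin N → ℂ × ℂ) :=
  LinearMap.pi fun h => (ev (t h)).toLinearMap.prod (dEv (t h) (w h))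

theorem jetMap_eq_zero {N : ℕ} {t : Fin N → ℂˣ × ℂˣ} {w : Fin N → (ℤ × ℤ →+ ℂ)} {F : Lau} :
    jetMap t w F = 0 ↔ ∀ h, ev (t h) F = 0 ∧ dEv (t h) (w h) F = 0 := by
  simp [jetMap, funext_iff, Prod.ext_iff]

theorem delta_zero (t : ℂˣ × ℂˣ) : delta t 0 = 1 := by rw [delta_apply, neg_zero, chr_zero]

theorem card_add_one_le_finrank {N : ℕ} (t : Fin N → ℂˣ × ℂˣ) (w₀ : Fin N → ℂ)
    (w : Fin N → (ℤ × ℤ →+ ℂ)) (S : Finset (ℤ × ℤ)) (h₀ : Fin N)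
    (hA : ∀ p ∈ S, (∑ h, (w₀ h • delta (t h) + moment (t h) (w h)) : Ser) (-p) = 0) :
    S.card + 1 ≤ 2 * N +
      Module.finrank ℂ (lauOn (S : Set (ℤ × ℤ)) ⊓ LinearMap.ker (jetMap t w) : Submodule ℂ Lau) := by
  set J := (jetMap t w).domRestrict (lauOn (S : Set (ℤ × ℤ))) with hJ
  have h1 := J.finrank_range_add_finrank_ker
  rw [finrank_lauOn] at h1
  have h2 : Module.finrank ℂ (LinearMap.ker J) = Module.finrank ℂ
      (lauOn (S : Set (ℤ × ℤ)) ⊓ LinearMap.ker (jetMap t w) : Submodule ℂ Lau) := by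
    rw [← Submodule.map_comap_subtype, LinearEquiv.finrank_eq
      (Submodule.equivMapOfInjective _ (Submodule.injective_subtype _) _).symm]
    rfl
  let l : Module.Dual ℂ (Fin N → ℂ × ℂ) :=
    ∑ h, (w₀ h • (LinearMap.fst ℂ ℂ ℂ ∘ₗ LinearMap.proj h) + LinearMap.snd ℂ ℂ ℂ ∘ₗ LinearMap.proj h)
  have hl : ∀ v, l v = ∑ h, (w₀ h * (v h).1 + (v h).2) := by
    intro v
    simp [l]
  have hl0 : l ≠ 0 := by
    intro h
    have := hl (Pi.single h₀ (0, 1))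
    rw [h, LinearMap.zero_apply, Finset.sum_eq_single h₀] at this
    · simp at this
    · intro b _ hb
      simp [Pi.single_eq_of_ne hb]
    · simp
  have h3 := Module.Dual.finrank_ker_add_one_of_ne_zero hl0
  have h4 : Module.finrank ℂ (Fin N → ℂ × ℂ) = 2 * N := by
    simp [Module.finrank_pi_fintype, mul_comm]
  have h5 : LinearMap.range J ≤ LinearMap.ker l := by
    rintro _ ⟨⟨F, hF⟩, rfl⟩
    rw [LinearMap.mem_ker, hl]
    have e1 := congrFun (smul_sum_moment t w₀ w F) 0
    have e2 : (F • ∑ h, (w₀ h • delta (t h) + moment (t h) (w h)) : Ser) 0 = 0 := by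
      rw [smul_apply]
      refine Finset.sum_eq_zero fun p hp => ?_
      beta_reduce
      rw [zero_sub, hA p (hF p (Finsupp.mem_support_iff.1 hp)), mul_zero]
    rw [e2, Ser.sum_apply] at e1
    rw [e1]
    refine Finset.sum_congr rfl fun h _ => ?_
    rw [add_apply, csmul_apply, csmul_apply, delta_zero, moment_apply]
    simp [J, jetMap]
  have h6 := Submodule.finrank_mono h5
  omega

theorem not_card_add_le {N : ℕ} {K : Set (ℝ × ℝ)} (hKconv : Convex ℝ K)
    (hKb : Bornology.IsBounded K) {S D : Finset (ℤ × ℤ)} (hS : ∀ p, p ∈ S ↔ latPt p ∈ K)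
    (hD : ∀ p, p ∈ D ↔ latPt p ∈ Inn K) {P : Lau} (hP : Prime P)
    (hPK : ∀ p, P.coeff p ≠ 0 → latPt p ∈ K) {t : Fin N → ℂˣ × ℂˣ} (ht : Function.Injective t)
    (hPt : ∀ h, ev (t h) P = 0) (hdP : ∀ h w, dEv (t h) w P = 0)
    (hnode : ∀ h, ∃ f : Lau, (∀ p, f.coeff p ≠ 0 → P.coeff p ≠ 0) ∧ ev (t h) f = 0 ∧
      ∃ w, dEv (t h) w f ≠ 0)
    (w₀ : Fin N → ℂ) (w : Fin N → (ℤ × ℤ →+ ℂ)) (h₀ : Fin N)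
    (hw : w₀ h₀ ≠ 0 ∨ w h₀ (1, 0) ≠ 0 ∨ w h₀ (0, 1) ≠ 0)
    (hA : ∀ p, latPt p ∈ K → (∑ h, (w₀ h • delta (t h) + moment (t h) (w h)) : Ser) (-p) = 0) :
    S.card < D.card + 2 * N + 1 := by
  by_contra! hcard
  set A : Ser := ∑ h, (w₀ h • delta (t h) + moment (t h) (w h)) with hAdef
  have hV := card_add_one_le_finrank t w₀ w S h₀ (fun p hp => hA p ((hS p).1 hp))
  set V : Submodule ℂ Lau := lauOn (S : Set (ℤ × ℤ)) ⊓ LinearMap.ker (jetMap t w) with hVdef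
  have hVS : ∀ F ∈ V, ∀ p ∈ F.coeff.support, latPt p ∈ K := fun F hF p hp =>
    (hS p).1 (hF.1 p (Finsupp.mem_support_iff.1 hp))
  have hVj : ∀ F ∈ V, ∀ h, ev (t h) F = 0 ∧ dEv (t h) (w h) F = 0 := fun F hF =>
    jetMap_eq_zero.1 hF.2
  have hVA : ∀ F ∈ V, F • A = 0 := by
    intro F hF
    rw [hAdef, smul_sum_moment]
    refine Finset.sum_eq_zero fun h _ => ?_
    rw [(hVj F hF h).1, (hVj F hF h).2]
    simp
  have hPV : P ∈ V := ⟨fun p hp => (hS p).2 (hPK p hp),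
    jetMap_eq_zero.2 fun h => ⟨hPt h, hdP h _⟩⟩
  have hP0 := hP.ne_zero
  -- a lattice point that can be shifted into the interior
  set K₀ := convexHull ℝ (latPt '' {p | P.coeff p ≠ 0}) with hK₀
  have hPK₀ : ∀ p, P.coeff p ≠ 0 → latPt p ∈ K₀ := fun p hp =>
    subset_convexHull ℝ _ ⟨p, hp, rfl⟩
  have hfin : (latPt '' {p | P.coeff p ≠ 0}).Finite := by
    refine Set.Finite.image _ (P.coeff.support.finite_toSet.subset fun p hp => ?_)
    exact Finsupp.mem_support_iff.2 hp
  have hcpt : IsCompact K₀ := hfin.isCompact_convexHull (𝕜 := ℝ)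
  obtain ⟨f, hf1, hf2⟩ := hnode h₀
  obtain ⟨o, ho⟩ := exists_latPt_mem_inn hP (convex_convexHull ℝ _) hcpt.isClosed hcpt.isBounded
    hPK₀ (t h₀) (hPt h₀) (hdP h₀) ⟨f, fun p hp => hPK₀ p (hf1 p hp), hf2⟩
  -- the twisted bracket
  obtain ⟨M, hM⟩ := hKb.exists_norm_le
  obtain ⟨c, hc⟩ := exists_isColumnCut K (M + 1) fun k hk => by
    have h1 := hM k hk
    have h2 := norm_snd_le k
    rw [Real.norm_eq_abs] at h2
    linarith
  set B := colCut c A with hB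
  have hVB : ∀ F ∈ V, F • B ∈ colFinite := fun F hF => smul_cut_below_mem _ (hVA F hF)
  have hsupp : ∀ F ∈ V, ∀ H ∈ V, ∀ u, bracket B F H u ≠ 0 → u ∈ D := fun F hF H hH u hu =>
    (hD u).2 (bracket_colCut_support_inn hKconv hc (hVA F hF) (hVA H hH) (hVS F hF) (hVS H hH) hA hu)
  have hdvd : ∀ F ∈ V, bracket B F P = 0 → P ∣ F := by
    intro F hF hFP
    by_contra hdiv
    obtain ⟨g, c', hc', hg⟩ := exists_smul_eq_delta ht w₀ w h₀ hw
    refine bracket_ne_of_smul_sub_mem hP hdiv (t h₀) (hPt h₀) (hVj F hF h₀).1 (hVB P hPV)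
      (hVB F hF) g hc' ?_ 0 0 (by rw [hFP]; simp)
    have e1 := cut_below_smul_sub_mem (fun n => -c (-n)) g A
    have e2 := cut_below_sub_mem (fun n => -c (-n)) (fun _ => 0) (g • A)
    have e3 : cut (below fun _ => 0) (g • A) = c' • halfDelta (t h₀) := by
      rw [hAdef, hg, map_smul]; rfl
    rw [e3] at e2
    have := sub_mem e2 e1
    convert this using 1
    rw [hB]
    change g • cut (below fun n => -c (-n)) A - _ = _
    abel
  let Ω : V →ₗ[ℂ] lauOn (D : Set (ℤ × ℤ)) := truncate D ∘ₗ bracketL B P ∘ₗ V.subtype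
  have hΩ : ∀ F : V, ofLau (Ω F) = bracket B F P := fun F =>
    ofLau_truncate D _ (hsupp F F.2 P hPV)
  let G : Submodule ℂ Lau :=
    (V ⊓ LinearMap.ker (bracketL B P)).comap (LinearMap.mulLeft ℂ P)
  have hG : ∀ g, g ∈ G ↔ P * g ∈ V ∧ bracket B (P * g) P = 0 := fun g => Iff.rfl
  let I : Submodule ℂ Lau := (LinearMap.range Ω).map (lauOn (D : Set (ℤ × ℤ))).subtype
  have hI : Module.finrank ℂ I = Module.finrank ℂ (LinearMap.range Ω) :=
    (LinearEquiv.finrank_eq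
      (Submodule.equivMapOfInjective _ (Submodule.injective_subtype _) _)).symm
  have hGD : G ≤ lauOn ((D.image (· - o) : Finset (ℤ × ℤ)) : Set (ℤ × ℤ)) := by
    intro g hg s hs
    rw [Finset.mem_coe, Finset.mem_image]
    refine ⟨s + o, (hD _).2 (add_mem_inn_of_mul_mem hP0 (fun p hp => ?_) ho hs), by simp⟩
    exact hVS _ ((hG g).1 hg).1 p (Finsupp.mem_support_iff.2 hp)
  have hGfin : FiniteDimensional ℂ G := Submodule.finiteDimensional_of_le hGD
  have hGcard : Module.finrank ℂ G ≤ D.card := by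
    refine (Submodule.finrank_mono hGD).trans ?_
    rw [finrank_lauOn]
    exact Finset.card_image_le
  have hVfin : FiniteDimensional ℂ V := Submodule.finiteDimensional_of_le inf_le_left
  have hker : Module.finrank ℂ (LinearMap.ker Ω) ≤ Module.finrank ℂ G := by
    have h1 : (LinearMap.ker Ω).map V.subtype ≤ G.map (LinearMap.mulLeft ℂ P) := by
      rintro _ ⟨F, hF, rfl⟩
      have hF0 : bracket B F P = 0 := by
        rw [← hΩ F, LinearMap.mem_ker.1 hF]
        simp
      obtain ⟨g, hg⟩ := hdvd F F.2 hF0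
      refine ⟨g, (hG g).2 ?_, hg.symm⟩
      rw [← hg]
      exact ⟨F.2, hF0⟩
    have h2 := Submodule.finrank_mono h1
    rw [← LinearEquiv.finrank_eq
      (Submodule.equivMapOfInjective _ (Submodule.injective_subtype _) _)] at h2
    exact h2.trans (Submodule.finrank_map_le _ _)
  have hrn := Ω.finrank_range_add_finrank_ker
  have hG0 : G ≠ ⊥ := by
    rw [Submodule.ne_bot_iff]
    refine ⟨1, (hG 1).2 ?_, one_ne_zero⟩
    rw [mul_one]
    exact ⟨hPV, bracket_self B P⟩
  have hI0 : I ≠ ⊥ := by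
    intro h
    rw [h, finrank_bot] at hI
    omega
  have hIle : I ≤ lauOn (D : Set (ℤ × ℤ)) := Submodule.map_subtype_le _ _
  have := finrank_add_finrank_le hGD hIle hG0 hI0 (D := D) (by
    rintro g hg _ ⟨_, ⟨F, rfl⟩, rfl⟩ p hp
    obtain ⟨hg1, hg2⟩ := (hG g).1 hg
    have h0 : bracket B P (P * g) = 0 := by rw [bracket_swap, hg2, neg_zero]
    have h1 : bracket B F (P * g) = ofLau (g * (Ω F : Lau)) := by
      rw [bracket_mul_right_of_eq_zero hP0 (hVB P hPV) g h0, ← hΩ, ← smul_eq_mul, ofLau.map_smul]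
    refine hsupp F F.2 (P * g) hg1 p ?_
    rw [h1, ofLau_apply]
    exact hp)
  omega

/-- The inclusion of polynomials into Laurent polynomials. -/
noncomputable def toLau : MvPolynomial (Fin 2) ℂ →ₐ[ℂ] Lau :=
  aeval ![AddMonoidAlgebra.single (1, 0) 1, AddMonoidAlgebra.single (0, 1) 1]

/-- The exponent of a monomial, as a lattice point. -/
def expPt (m : Fin 2 →₀ ℕ) : ℤ × ℤ := (m 0, m 1)

theorem expPt_injective : Function.Injective expPt := by
  intro m n h
  simp only [expPt, Prod.mk.injEq, Nat.cast_inj] at h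
  ext i
  fin_cases i
  exacts [h.1, h.2]

theorem toLau_monomial (m : Fin 2 →₀ ℕ) (c : ℂ) :
    toLau (monomial m c) = AddMonoidAlgebra.single (expPt m) c := by
  rw [toLau, aeval_monomial, Finsupp.prod_fintype _ _ (fun _ => pow_zero _), Fin.prod_univ_two,
    AddMonoidAlgebra.coe_algebraMap]
  simp [AddMonoidAlgebra.single_pow, AddMonoidAlgebra.single_mul_single, expPt]

theorem coeff_toLau_expPt (f : MvPolynomial (Fin 2) ℂ) (m : Fin 2 →₀ ℕ) :
    (toLau f).coeff (expPt m) = f.coeff m := by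
  induction f using MvPolynomial.induction_on' with
  | monomial n c =>
    rw [toLau_monomial, AddMonoidAlgebra.coeff_single, Finsupp.single_apply, coeff_monomial]
    simp only [expPt_injective.eq_iff]
  | add f g hf hg =>
    rw [map_add, AddMonoidAlgebra.coeff_add, Finsupp.add_apply, hf, hg, coeff_add]

theorem exists_expPt_of_coeff_toLau_ne_zero {f : MvPolynomial (Fin 2) ℂ} {p : ℤ × ℤ}
    (h : (toLau f).coeff p ≠ 0) : ∃ m, p = expPt m := by
  induction f using MvPolynomial.induction_on' with
  | monomial n c =>
    rw [toLau_monomial, AddMonoidAlgebra.coeff_single, Finsupp.single_apply] at h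
    exact ⟨n, (by_contra fun hn => h (if_neg hn) : expPt n = p).symm⟩
  | add f g hf hg =>
    rw [map_add, AddMonoidAlgebra.coeff_add, Finsupp.add_apply] at h
    by_cases hf0 : (toLau f).coeff p = 0
    · exact hg fun hg0 => h (by rw [hf0, hg0, add_zero])
    · exact hf hf0

theorem toLau_injective : Function.Injective toLau := by
  intro f g h
  ext m
  rw [← coeff_toLau_expPt, h, coeff_toLau_expPt]

theorem isUnit_toLau_monomial (m : Fin 2 →₀ ℕ) : IsUnit (toLau (monomial m 1)) := by
  rw [toLau_monomial]
  refine IsUnit.of_mul_eq_one (AddMonoidAlgebra.single (-expPt m) 1) ?_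
  rw [AddMonoidAlgebra.single_mul_single, add_neg_cancel, mul_one, AddMonoidAlgebra.one_def]

theorem exists_mul_toLau_eq (a : Lau) :
    ∃ Q q : MvPolynomial (Fin 2) ℂ, IsUnit (toLau Q) ∧ a * toLau Q = toLau q := by
  induction a using AddMonoidAlgebra.induction_linear with
  | zero => exact ⟨1, 0, by simp, by simp⟩
  | add a b ha hb =>
    obtain ⟨Q, q, hQ, hq⟩ := ha
    obtain ⟨Q', q', hQ', hq'⟩ := hb
    refine ⟨Q * Q', q * Q' + q' * Q, by rw [map_mul]; exact hQ.mul hQ', ?_⟩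
    simp only [map_mul, map_add, ← hq, ← hq']
    ring
  | single p c =>
    refine ⟨monomial (Finsupp.single 0 (-p.1).toNat + Finsupp.single 1 (-p.2).toNat) 1,
      monomial (Finsupp.single 0 p.1.toNat + Finsupp.single 1 p.2.toNat) c,
      isUnit_toLau_monomial _, ?_⟩
    rw [toLau_monomial, toLau_monomial, AddMonoidAlgebra.single_mul_single, mul_one]
    congr 1
    ext <;> simp [expPt] <;> omega

theorem ev_toLau {t : ℂˣ × ℂˣ} {z : Fin 2 → ℂ} (h0 : z 0 = t.1) (h1 : z 1 = t.2)
    (f : MvPolynomial (Fin 2) ℂ) : ev t (toLau f) = eval z f := by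
  have : (ev t).comp toLau = aeval z := by
    apply MvPolynomial.algHom_ext
    intro i
    fin_cases i <;> simp [toLau, chr, h0, h1]
  have h := DFunLike.congr_fun this f
  rwa [AlgHom.comp_apply, MvPolynomial.aeval_eq_eval] at h

theorem dEv_toLau {t : ℂˣ × ℂˣ} {z : Fin 2 → ℂ} (h0 : z 0 = t.1) (h1 : z 1 = t.2)
    (w : ℤ × ℤ →+ ℂ) (f : MvPolynomial (Fin 2) ℂ) :
    dEv t w (toLau f) = w (1, 0) * z 0 * eval z (pderiv 0 f) +
      w (0, 1) * z 1 * eval z (pderiv 1 f) := by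
  induction f using MvPolynomial.induction_on with
  | C a =>
    rw [show (C a : MvPolynomial (Fin 2) ℂ) = monomial 0 a from rfl, toLau_monomial]
    simp [expPt, ← Prod.zero_eq_mk]
  | add f g hf hg => simp only [map_add, hf, hg]; ring
  | mul_X f i hf =>
    rw [map_mul, dEv_mul, hf, ev_toLau h0 h1, ev_toLau h0 h1]
    fin_cases i
    · simp [toLau, chr, Derivation.leibniz, pderiv_X, h0, h1]; ring
    · simp [toLau, chr, Derivation.leibniz, pderiv_X, h0, h1]; ring

theorem prime_toLau {P : MvPolynomial (Fin 2) ℂ} (hP : Prime P) (hu : ¬ IsUnit (toLau P)) :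
    Prime (toLau P) := by
  refine ⟨(map_ne_zero_iff _ toLau_injective).2 hP.ne_zero, hu, ?_⟩
  rintro a b ⟨q, hq⟩
  obtain ⟨A, a', hA, ha⟩ := exists_mul_toLau_eq a
  obtain ⟨B, b', hB, hb⟩ := exists_mul_toLau_eq b
  obtain ⟨Q, q', hQ, hq'⟩ := exists_mul_toLau_eq q
  have key : a' * b' * Q = P * (q' * A * B) := by
    apply toLau_injective
    simp only [map_mul, ← ha, ← hb, ← hq']
    linear_combination (toLau A * toLau B * toLau Q) * hq
  rcases hP.dvd_or_dvd ⟨_, key⟩ with h | h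
  · rcases hP.dvd_or_dvd h with h | h
    · left
      have := map_dvd toLau h
      rwa [← ha, hA.dvd_mul_right] at this
    · right
      have := map_dvd toLau h
      rwa [← hb, hB.dvd_mul_right] at this
  · exact absurd (isUnit_of_dvd_unit (map_dvd toLau h) hQ) hu

theorem coeff_X_mul_pderiv (i : Fin 2) (f : MvPolynomial (Fin 2) ℂ) (m : Fin 2 →₀ ℕ) :
    (X i * pderiv i f).coeff m = m i * f.coeff m := by
  induction f using MvPolynomial.induction_on' with
  | monomial n c =>
    rw [X_mul_pderiv_monomial, coeff_smul, coeff_monomial]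
    split_ifs with h
    · rw [h, nsmul_eq_mul]
    · simp
  | add f g hf hg => rw [map_add, mul_add, coeff_add, hf, hg, coeff_add]; ring

theorem coeff_toPoly {L : Finset (ℕ × ℕ)} (c : Coef L) {m : Fin 2 →₀ ℕ}
    (hm : (toPoly c).coeff m ≠ 0) : (m 0, m 1) ∈ L := by
  rw [toPoly, coeff_sum] at hm
  obtain ⟨p, -, hp⟩ := Finset.exists_ne_zero_of_sum_ne_zero hm
  rw [coeff_monomial] at hp
  have : Finsupp.single 0 p.1.1 + Finsupp.single 1 p.1.2 = m := by_contra fun h => hp (if_neg h)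
  rw [← this]
  simp

theorem toPoly_single {L : Finset (ℕ × ℕ)} (p : {p : ℕ × ℕ // p ∈ L}) :
    toPoly (Pi.single p (1 : ℂ) : Coef L) =
      monomial (Finsupp.single 0 p.1.1 + Finsupp.single 1 p.1.2) 1 := by
  rw [toPoly, Finset.sum_eq_single p]
  · rw [Pi.single_eq_same]
  · intro q _ hq
    rw [Pi.single_eq_of_ne hq, map_zero]
  · simp

/-- The polynomial of a coefficient vector, as a linear map. -/
noncomputable def toPolyL (L : Finset (ℕ × ℕ)) : Coef L →ₗ[ℂ] MvPolynomial (Fin 2) ℂ where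
  toFun := toPoly
  map_add' c d := by simp [toPoly, Finset.sum_add_distrib]
  map_smul' a c := by
    simp only [toPoly, Finset.smul_sum, smul_monomial, RingHom.id_apply, Pi.smul_apply]

theorem notMem_inn_of_forall_le {K : Set (ℝ × ℝ)} {x : ℝ × ℝ} {f : ℝ × ℝ →ₗ[ℝ] ℝ} (hf0 : f ≠ 0)
    (hf : ∀ k ∈ K, f k ≤ f x) : x ∉ Inn K := by
  intro hI
  have hlin : ∀ v, f v = f (1, 0) * v.1 + f (0, 1) * v.2 := by
    intro v
    have : v = v.1 • ((1, 0) : ℝ × ℝ) + v.2 • ((0, 1) : ℝ × ℝ) := by ext <;> simp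
    conv_lhs => rw [this]
    rw [map_add, map_smul, map_smul, smul_eq_mul, smul_eq_mul]
    ring
  have hne : f (1, 0) ≠ 0 ∨ f (0, 1) ≠ 0 := by
    by_contra! h
    apply hf0
    ext <;> simp [h.1, h.2]
  obtain ⟨k, hk, hlt⟩ := hI _ _ hne
  rw [← hlin, ← hlin] at hlt
  exact absurd (hf k hk) (not_le.2 hlt)

theorem inn_subset {K : Set (ℝ × ℝ)} (hK : Convex ℝ K) (hKc : IsClosed K) : Inn K ⊆ K := by
  intro x hx
  by_contra hxK
  obtain ⟨f, u, hf, hu⟩ := geometric_hahn_banach_closed_point hK hKc hxK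
  obtain ⟨y, hy, -⟩ := hx 1 0 (Or.inl one_ne_zero)
  refine notMem_inn_of_forall_le (f := f.toLinearMap) ?_ (fun k hk => ((hf k hk).trans hu).le) hx
  intro h
  have h1 := (hf y hy).trans hu
  have h2 : ∀ v, f v = 0 := fun v => DFunLike.congr_fun h v
  rw [h2, h2] at h1
  exact lt_irrefl _ h1

theorem notMem_inn_of_mem_frontier {K : Set (ℝ × ℝ)} (hK : Convex ℝ K) (hKc : IsClosed K)
    {x : ℝ × ℝ} (hx : x ∈ frontier K) : x ∉ Inn K := by
  have hxK := hKc.frontier_subset hx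
  have hxi : x ∉ interior K := hx.2
  obtain ⟨f, hf0, hf⟩ : ∃ f : ℝ × ℝ →ₗ[ℝ] ℝ, f ≠ 0 ∧ ∀ k ∈ K, f k ≤ f x := by
    by_cases hne : (interior K).Nonempty
    · obtain ⟨f, hf⟩ := geometric_hahn_banach_open_point hK.interior isOpen_interior hxi
      refine ⟨f, ?_, ?_⟩
      · rintro h
        obtain ⟨y, hy⟩ := hne
        have h1 := hf y hy
        have h2 : ∀ v, f v = 0 := fun v => DFunLike.congr_fun h v
        rw [h2, h2] at h1
        exact lt_irrefl _ h1
      · intro k hk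
        have h1 : k ∈ closure (interior K) := by
          rw [hK.closure_interior_eq_closure_of_nonempty_interior hne]
          exact subset_closure hk
        exact closure_minimal (fun y hy => (hf y hy).le)
          (isClosed_le f.continuous continuous_const) h1
    · rw [hK.interior_nonempty_iff_affineSpan_eq_top] at hne
      have h1 : (affineSpan ℝ K).direction < ⊤ := by
        rw [lt_top_iff_ne_top, Ne,
          AffineSubspace.direction_eq_top_iff_of_nonempty ⟨x, subset_affineSpan ℝ K hxK⟩]
        exact hne
      obtain ⟨f, hf0, hf⟩ := Submodule.exists_le_ker_of_lt_top _ h1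
      refine ⟨f, hf0, fun k hk => ?_⟩
      have h2 := hf (AffineSubspace.vsub_mem_direction (subset_affineSpan ℝ K hk)
        (subset_affineSpan ℝ K hxK))
      rw [LinearMap.mem_ker, vsub_eq_sub, map_sub, sub_eq_zero] at h2
      exact h2.le
  exact notMem_inn_of_forall_le hf0 hf

/-- The inclusion of the lattice points of the quadrant. -/
def natPt (p : ℕ × ℕ) : ℤ × ℤ := (p.1, p.2)

theorem natPt_injective : Function.Injective natPt := by
  rintro ⟨a, b⟩ ⟨c, d⟩ h
  simpa [natPt] using h

theorem latPt_natPt (p : ℕ × ℕ) : latPt (natPt p) = toR p := by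
  simp [latPt, natPt, toR]

theorem latPt_mem_hullOf {L : Finset (ℕ × ℕ)} (hL : IsLatticePolytopeSet L) (p : ℤ × ℤ) :
    latPt p ∈ hullOf L ↔ p ∈ L.image natPt := by
  rw [Finset.mem_image]
  constructor
  · intro hp
    have hconv : Convex ℝ {k : ℝ × ℝ | 0 ≤ k} := convex_Ici 0
    have h0 : (0 : ℝ × ℝ) ≤ latPt p := convexHull_min (s := toR '' L) (by
      rintro _ ⟨q, -, rfl⟩
      exact ⟨Nat.cast_nonneg _, Nat.cast_nonneg _⟩) hconv hp
    have h1 : 0 ≤ p.1 := Int.cast_nonneg_iff.1 h0.1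
    have h2 : 0 ≤ p.2 := Int.cast_nonneg_iff.1 h0.2
    have h3 : natPt (p.1.toNat, p.2.toNat) = p := by
      ext <;> simp [natPt, h1, h2]
    refine ⟨_, (hL _).1 ?_, h3⟩
    rwa [← latPt_natPt, h3]
  · rintro ⟨q, hq, rfl⟩
    rw [latPt_natPt]
    exact (hL q).2 hq

theorem hullOf_isCompact (L : Finset (ℕ × ℕ)) : IsCompact (hullOf L) :=
  (L.finite_toSet.image toR).isCompact_convexHull (𝕜 := ℝ)

open Classical in
theorem card_inn_add_boundaryLatticeCount_le {L : Finset (ℕ × ℕ)} (hL : IsLatticePolytopeSet L) :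
    ((L.image natPt).filter (fun p => latPt p ∈ Inn (hullOf L))).card + boundaryLatticeCount L ≤
      (L.image natPt).card := by
  rw [← Finset.card_filter_add_card_filter_not (s := L.image natPt)
    (fun p => latPt p ∈ Inn (hullOf L))]
  apply Nat.add_le_add_left
  rw [boundaryLatticeCount, ← Set.ncard_coe_finset, ← Set.ncard_image_of_injective _ natPt_injective]
  apply Set.ncard_le_ncard _ (Finset.finite_toSet _)
  rintro _ ⟨p, hp, rfl⟩
  rw [Finset.mem_coe, Finset.mem_filter, ← latPt_mem_hullOf hL, latPt_natPt]
  exact ⟨(hullOf_isCompact L).isClosed.frontier_subset hp,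
    notMem_inn_of_mem_frontier (convex_convexHull ℝ _) (hullOf_isCompact L).isClosed hp⟩

theorem exists_dEv_ne_zero_of_isNodeAt {P : MvPolynomial (Fin 2) ℂ} {z : Fin 2 → ℂ}
    (hz : IsNodeAt P z) (t : ℂˣ × ℂˣ) (h0 : z 0 = t.1) (h1 : z 1 = t.2) :
    ∃ f : Lau, (∀ p, f.coeff p ≠ 0 → (toLau P).coeff p ≠ 0) ∧ ev t f = 0 ∧
      ∃ w, dEv t w f ≠ 0 := by
  obtain ⟨⟨hz0, hz1, -, hd0, -⟩, hH⟩ := hz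
  refine ⟨toLau (X 0 * pderiv 0 P), ?_, ?_, ?_⟩
  · intro p hp
    obtain ⟨m, rfl⟩ := exists_expPt_of_coeff_toLau_ne_zero hp
    rw [coeff_toLau_expPt, coeff_X_mul_pderiv] at hp
    rw [coeff_toLau_expPt]
    exact right_ne_zero_of_mul hp
  · rw [ev_toLau h0 h1, map_mul, hd0, mul_zero]
  · by_contra! hw
    have e0 := hw (((Int.castRingHom ℂ).toAddMonoidHom).comp (AddMonoidHom.fst ℤ ℤ))
    have e1 := hw (((Int.castRingHom ℂ).toAddMonoidHom).comp (AddMonoidHom.snd ℤ ℤ))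
    rw [dEv_toLau h0 h1] at e0 e1
    simp [Derivation.leibniz, pderiv_X, hd0, hz0, hz1] at e0 e1
    rw [e0, e1] at hH
    simp at hH

/-- The nodes impose independent conditions on the first order jets of the polynomials with a given
Newton polygon, provided that there are few of them. -/
theorem exists_jets_eq {L : Finset (ℕ × ℕ)} (hL : IsLatticePolytopeSet L) {N : ℕ} {P : Coef L}
    (hirr : Irreducible (toPoly P)) {t : Fin N → (Fin 2 → ℂ)} (ht : Function.Injective t)
    (hnodes : ∀ h, IsNodeAt (toPoly P) (t h)) (hcount : 2 * N < boundaryLatticeCount L)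
    (v : Fin N → Fin 3 → ℂ) :
    ∃ c : Coef L, ∀ h, eval (t h) (toPoly c) = v h 0 ∧
      eval (t h) (pderiv 0 (toPoly c)) = v h 1 ∧ eval (t h) (pderiv 1 (toPoly c)) = v h 2 := by
  classical
  let J : Coef L →ₗ[ℂ] (Fin N → Fin 3 → ℂ) := LinearMap.pi fun h => LinearMap.pi
    ![(aeval (t h)).toLinearMap ∘ₗ toPolyL L,
      (aeval (t h)).toLinearMap ∘ₗ (pderiv 0).toLinearMap ∘ₗ toPolyL L,
      (aeval (t h)).toLinearMap ∘ₗ (pderiv 1).toLinearMap ∘ₗ toPolyL L]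
  have hJ : ∀ c h, J c h 0 = eval (t h) (toPoly c) ∧ J c h 1 = eval (t h) (pderiv 0 (toPoly c)) ∧
      J c h 2 = eval (t h) (pderiv 1 (toPoly c)) := fun c h => ⟨rfl, rfl, rfl⟩
  suffices hrange : LinearMap.range J = ⊤ by
    obtain ⟨c, hc⟩ := LinearMap.range_eq_top.1 hrange v
    refine ⟨c, fun h => ?_⟩
    rw [← hc]
    exact ⟨(hJ c h).1.symm, (hJ c h).2.1.symm, (hJ c h).2.2.symm⟩
  by_contra hne
  obtain ⟨f, hf0, hf⟩ := Submodule.exists_le_ker_of_lt_top _ (lt_top_iff_ne_top.2 hne)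
  let a : Fin N → Fin 3 → ℂ := fun h i => f (Pi.single h (Pi.single i 1))
  have hfa : ∀ u, f u = ∑ h, (a h 0 * u h 0 + a h 1 * u h 1 + a h 2 * u h 2) := by
    intro u
    have h1 : u = ∑ h, ∑ i, u h i • (Pi.single h (Pi.single i 1) : Fin N → Fin 3 → ℂ) := by
      ext h i
      simp [Finset.sum_apply, Pi.single_apply, Finset.sum_ite_eq, ite_apply]
    conv_lhs => rw [h1]
    rw [map_sum]
    refine Finset.sum_congr rfl fun h _ => ?_
    rw [map_sum, Fin.sum_univ_three]
    simp only [map_smul, smul_eq_mul, a]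
    ring
  obtain ⟨h₀, ha⟩ : ∃ h, a h 0 ≠ 0 ∨ a h 1 ≠ 0 ∨ a h 2 ≠ 0 := by
    by_contra! h
    apply hf0
    apply LinearMap.ext
    intro u
    rw [hfa]
    refine Finset.sum_eq_zero fun s _ => ?_
    rw [(h s).1, (h s).2.1, (h s).2.2]
    ring
  let τ : Fin N → ℂˣ × ℂˣ := fun h =>
    (Units.mk0 (t h 0) (hnodes h).1.1, Units.mk0 (t h 1) (hnodes h).1.2.1)
  have hτ0 : ∀ h, t h 0 = (τ h).1 := fun h => rfl
  have hτ1 : ∀ h, t h 1 = (τ h).2 := fun h => rfl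
  have hτ : Function.Injective τ := by
    intro h h' hh
    apply ht
    ext i
    fin_cases i
    · exact (hτ0 h).trans ((congrArg (fun x => (x.1 : ℂ)) hh).trans (hτ0 h').symm)
    · exact (hτ1 h).trans ((congrArg (fun x => (x.2 : ℂ)) hh).trans (hτ1 h').symm)
  let w : Fin N → (ℤ × ℤ →+ ℂ) := fun h =>
    ((AddMonoidHom.mulRight (a h 1 / t h 0)).comp (Int.castRingHom ℂ).toAddMonoidHom).coprod
      ((AddMonoidHom.mulRight (a h 2 / t h 1)).comp (Int.castRingHom ℂ).toAddMonoidHom)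
  have hw1 : ∀ h, w h (1, 0) = a h 1 / t h 0 := fun h => by simp [w]
  have hw2 : ∀ h, w h (0, 1) = a h 2 / t h 1 := fun h => by simp [w]
  have hev : ∀ h c, a h 0 * ev (τ h) (toLau (toPoly c)) + dEv (τ h) (w h) (toLau (toPoly c)) =
      a h 0 * J c h 0 + a h 1 * J c h 1 + a h 2 * J c h 2 := by
    intro h c
    have e0 := (hnodes h).1.1
    have e1 := (hnodes h).1.2.1
    rw [ev_toLau (hτ0 h) (hτ1 h), dEv_toLau (hτ0 h) (hτ1 h), hw1, hw2, (hJ c h).1, (hJ c h).2.1,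
      (hJ c h).2.2]
    field_simp
    ring
  have hPt : ∀ h, ev (τ h) (toLau (toPoly P)) = 0 := fun h => by
    rw [ev_toLau (hτ0 h) (hτ1 h), (hnodes h).1.2.2.1]
  have hcard := not_card_add_le (convex_convexHull ℝ _) (hullOf_isCompact L).isBounded
    (S := L.image natPt) (D := (L.image natPt).filter (fun p => latPt p ∈ Inn (hullOf L)))
    (fun p => (latPt_mem_hullOf hL p).symm) (P := toLau (toPoly P)) (t := τ) (fun p => ?_)
    (prime_toLau hirr.prime fun hu => ?_) (fun p hp => ?_) hτ hPt (fun h w' => ?_)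
    (fun h => exists_dEv_ne_zero_of_isNodeAt (hnodes h) (τ h) (hτ0 h) (hτ1 h))
    (fun h => a h 0) w h₀ ?_ fun p hp => ?_
  · have := card_inn_add_boundaryLatticeCount_le hL
    omega
  · rw [Finset.mem_filter, ← latPt_mem_hullOf hL]
    exact ⟨And.right, fun h =>
      ⟨inn_subset (convex_convexHull ℝ _) (hullOf_isCompact L).isClosed h, h⟩⟩
  · have := hu.map (ev (τ h₀))
    rw [hPt] at this
    exact not_isUnit_zero this
  · obtain ⟨m, rfl⟩ := exists_expPt_of_coeff_toLau_ne_zero hp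
    rw [coeff_toLau_expPt] at hp
    refine (latPt_mem_hullOf hL _).2 ?_
    exact Finset.mem_image_of_mem natPt (coeff_toPoly P hp)
  · rw [dEv_toLau (hτ0 h) (hτ1 h), (hnodes h).1.2.2.2.1, (hnodes h).1.2.2.2.2]
    ring
  · rw [hw1, hw2, div_ne_zero_iff, div_ne_zero_iff]
    have e0 := (hnodes h₀).1.1
    have e1 := (hnodes h₀).1.2.1
    tauto
  · obtain ⟨q, hq, rfl⟩ := Finset.mem_image.1 ((latPt_mem_hullOf hL p).1 hp)
    have e1 := hf (LinearMap.mem_range_self J (Pi.single ⟨q, hq⟩ 1))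
    rw [LinearMap.mem_ker, hfa] at e1
    rw [Ser.sum_apply, ← e1]
    refine Finset.sum_congr rfl fun h _ => ?_
    rw [← hev, toPoly_single, toLau_monomial, ev_single, dEv_single, add_apply, csmul_apply,
      delta_apply, moment_apply, neg_neg]
    have : expPt (Finsupp.single 0 q.1 + Finsupp.single 1 q.2) = natPt q := by
      simp [expPt, natPt]
    rw [this]
    ring

end

open Topology in
theorem eventually_surjective_fderiv {E F : Type*} [NormedAddCommGroup E] [NormedSpace ℂ E]
    [NormedAddCommGroup F] [NormedSpace ℂ F] [FiniteDimensional ℂ F] {f : E → F} {x : E}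
    (hf : AnalyticAt ℂ f x) (hx : Function.Surjective (fderiv ℂ f x)) :
    ∀ᶠ y in 𝓝 x, Function.Surjective (fderiv ℂ f y) := by
  have := FiniteDimensional.complete ℂ F
  obtain ⟨s, hs⟩ := (fderiv ℂ f x).toLinearMap.exists_rightInverse_of_surjective
    (LinearMap.range_eq_top.2 hx)
  have hs' : (fderiv ℂ f x).comp (LinearMap.toContinuousLinearMap s) = 1 := by
    ext v
    exact DFunLike.congr_fun hs v
  have hc : ContinuousAt (fun y => (fderiv ℂ f y).comp (LinearMap.toContinuousLinearMap s)) x :=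
    hf.fderiv.continuousAt.clm_comp continuousAt_const
  have hU : ∀ᶠ y in 𝓝 x, IsUnit ((fderiv ℂ f y).comp (LinearMap.toContinuousLinearMap s)) := by
    refine hc.eventually_mem (s := {u | IsUnit u}) (Units.isOpen.mem_nhds ?_)
    rw [hs']
    exact isUnit_one
  filter_upwards [hU] with y hy v
  obtain ⟨u, hu⟩ := hy.exists_right_inv
  exact ⟨_, DFunLike.congr_fun hu v⟩

theorem hasFDerivAt_eval (f : MvPolynomial (Fin 2) ℂ) (z : Fin 2 → ℂ) :
    HasFDerivAt (fun z => eval z f)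
      (∑ i, eval z (pderiv i f) • (ContinuousLinearMap.proj i : (Fin 2 → ℂ) →L[ℂ] ℂ)) z := by
  induction f using MvPolynomial.induction_on with
  | C a =>
    convert! hasFDerivAt_const (𝕜 := ℂ) a z using 1
    · ext; simp
    · ext; simp
  | add f g hf hg =>
    convert! hf.add hg using 1
    · ext; simp
    · ext v
      simp
      ring
  | mul_X f i hf =>
    convert! hf.mul (hasFDerivAt_apply i z) using 1
    · ext; simp
    · ext v
      fin_cases i <;> simp [Derivation.leibniz, pderiv_X] <;> ring

theorem analyticAt_eval_toPoly {E : Type*} [NormedAddCommGroup E] [NormedSpace ℂ E]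
    {L : Finset (ℕ × ℕ)} (T : MvPolynomial (Fin 2) ℂ →ₗ[ℂ] MvPolynomial (Fin 2) ℂ)
    {c : E → Coef L} {g : E → (Fin 2 → ℂ)} {x : E} (hc : AnalyticAt ℂ c x)
    (hg : AnalyticAt ℂ g x) : AnalyticAt ℂ (fun y => eval (g y) (T (toPoly (c y)))) x := by
  have h : ∀ y, eval (g y) (T (toPoly (c y))) = ∑ p, c y p *
      eval (g y) (T (monomial (Finsupp.single 0 p.1.1 + Finsupp.single 1 p.1.2) 1)) := by
    intro y
    rw [toPoly, map_sum, map_sum]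
    refine Finset.sum_congr rfl fun p _ => ?_
    rw [← smul_eval, ← map_smul, smul_monomial, smul_eq_mul, mul_one]
  simp_rw [h]
  refine Finset.analyticAt_fun_sum _ fun p _ => ?_
  refine (analyticAt_pi_iff.1 hc p).mul ?_
  exact AnalyticAt.aeval_mvPolynomial (analyticAt_pi_iff.1 hg) _

open Topology ContDiff in
theorem exists_implicit_zero {L' L'' : Finset (ℕ × ℕ)} {Q : Coef L'} {R : Coef L''}
    {t : Fin 2 → ℂ} (hQ : eval t (toPoly Q) = 0) (hR : eval t (toPoly R) = 0)
    (htrans : eval t (pderiv 0 (toPoly Q)) * eval t (pderiv 1 (toPoly R)) -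
        eval t (pderiv 1 (toPoly Q)) * eval t (pderiv 0 (toPoly R)) ≠ 0) :
    ∃ ζ : Coef L' × Coef L'' → (Fin 2 → ℂ), AnalyticAt ℂ ζ (Q, R) ∧ ζ (Q, R) = t ∧
      ∀ᶠ p in 𝓝 ((Q, R), t),
        (eval p.2 (toPoly p.1.1) = 0 ∧ eval p.2 (toPoly p.1.2) = 0) ↔ ζ p.1 = p.2 := by
  let F : (Coef L' × Coef L'') × (Fin 2 → ℂ) → (Fin 2 → ℂ) := fun p =>
    ![eval p.2 (toPoly p.1.1), eval p.2 (toPoly p.1.2)]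
  have hF : AnalyticAt ℂ F ((Q, R), t) := by
    rw [analyticAt_pi_iff]
    intro i
    fin_cases i
    · exact analyticAt_eval_toPoly LinearMap.id (analyticAt_fst.comp analyticAt_fst) analyticAt_snd
    · exact analyticAt_eval_toPoly LinearMap.id (analyticAt_snd.comp analyticAt_fst) analyticAt_snd
  have hcd : ContDiffAt ℂ ω F ((Q, R), t) := hF.contDiffAt
  have hd : HasFDerivAt (fun z => F ((Q, R), z))
      (fderiv ℂ F ((Q, R), t) ∘L .inr ℂ (Coef L' × Coef L'') (Fin 2 → ℂ)) t :=
    hF.differentiableAt.hasFDerivAt.comp t (hasFDerivAt_prodMk_right _ _)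
  have hval : ∀ v, (fderiv ℂ F ((Q, R), t) ∘L .inr ℂ (Coef L' × Coef L'') (Fin 2 → ℂ)) v =
      ![eval t (pderiv 0 (toPoly Q)) * v 0 + eval t (pderiv 1 (toPoly Q)) * v 1,
        eval t (pderiv 0 (toPoly R)) * v 0 + eval t (pderiv 1 (toPoly R)) * v 1] := by
    intro v
    rw [hasFDerivAt_pi'] at hd
    have h0 := (hd 0).unique (hasFDerivAt_eval (toPoly Q) t)
    have h1 := (hd 1).unique (hasFDerivAt_eval (toPoly R) t)
    ext i
    fin_cases i
    · simpa using DFunLike.congr_fun h0 v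
    · simpa using DFunLike.congr_fun h1 v
  have hinv : (fderiv ℂ F ((Q, R), t) ∘L
      .inr ℂ (Coef L' × Coef L'') (Fin 2 → ℂ)).IsInvertible := by
    set M := fderiv ℂ F ((Q, R), t) ∘L .inr ℂ (Coef L' × Coef L'') (Fin 2 → ℂ)
    have hinj : Function.Injective M.toLinearMap := by
      rw [injective_iff_map_eq_zero]
      intro v hv
      have hv' := (hval v).symm.trans hv
      have e0 := congrFun hv' 0
      have e1 := congrFun hv' 1
      simp only [Matrix.cons_val_zero, Matrix.cons_val_one, Pi.zero_apply] at e0 e1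
      ext i
      fin_cases i
      · apply mul_left_cancel₀ htrans
        simp only [Fin.zero_eta, Pi.zero_apply]
        linear_combination eval t (pderiv 1 (toPoly R)) * e0 - eval t (pderiv 1 (toPoly Q)) * e1
      · apply mul_left_cancel₀ htrans
        simp only [Fin.mk_one, Pi.zero_apply]
        linear_combination eval t (pderiv 0 (toPoly Q)) * e1 - eval t (pderiv 0 (toPoly R)) * e0
    refine ⟨(LinearEquiv.ofInjectiveEndo M.toLinearMap hinj).toContinuousLinearEquiv, ?_⟩
    ext v
    rfl
  have hω : (ω : WithTop ℕ∞) ≠ 0 := by simp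
  refine ⟨hcd.implicitFunction hω hinv, (hcd.contDiffAt_implicitFunction hω hinv).analyticAt,
    hcd.implicitFunction_apply_self hω hinv, ?_⟩
  filter_upwards [hcd.eventually_apply_eq_iff_implicitFunction hω hinv] with p hp
  rw [← hp]
  simp [F, hQ, hR, _root_.funext_iff, Fin.forall_fin_two]

/-- The first order jet of the first polynomial at a point depending on the other two. -/
noncomputable def jetAlong {L L' L'' : Finset (ℕ × ℕ)} (ζ : Coef L' × Coef L'' → (Fin 2 → ℂ))
    (y : Coef L × Coef L' × Coef L'') : Fin 3 → ℂ :=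
  ![eval (ζ y.2) (toPoly y.1), eval (ζ y.2) (pderiv 0 (toPoly y.1)),
    eval (ζ y.2) (pderiv 1 (toPoly y.1))]

theorem analyticAt_jetAlong {L L' L'' : Finset (ℕ × ℕ)} {ζ : Coef L' × Coef L'' → (Fin 2 → ℂ)}
    {y : Coef L × Coef L' × Coef L''} (hζ : AnalyticAt ℂ ζ y.2) :
    AnalyticAt ℂ (jetAlong (L := L) ζ) y := by
  have h : AnalyticAt ℂ (fun y : Coef L × Coef L' × Coef L'' => ζ y.2) y :=
    hζ.comp analyticAt_snd
  rw [analyticAt_pi_iff]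
  intro i
  fin_cases i
  · exact analyticAt_eval_toPoly LinearMap.id analyticAt_fst h
  · exact analyticAt_eval_toPoly (pderiv 0).toLinearMap analyticAt_fst h
  · exact analyticAt_eval_toPoly (pderiv 1).toLinearMap analyticAt_fst h

open Topology in
theorem eventually_jetAlong_eq_zero_iff {L L' L'' : Finset (ℕ × ℕ)} {Q : Coef L'} {R : Coef L''}
    {ζ : Coef L' × Coef L'' → (Fin 2 → ℂ)} {t : Fin 2 → ℂ} (ht0 : t 0 ≠ 0) (ht1 : t 1 ≠ 0)
    (hζ : ContinuousAt ζ (Q, R)) (hζt : ζ (Q, R) = t)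
    (hz : ∀ᶠ p in 𝓝 ((Q, R), t),
      (eval p.2 (toPoly p.1.1) = 0 ∧ eval p.2 (toPoly p.1.2) = 0) ↔ ζ p.1 = p.2) (P : Coef L) :
    ∀ᶠ δ in 𝓝[>] (0 : ℝ), ∀ᶠ y in 𝓝 ((P, Q, R) : Coef L × Coef L' × Coef L''),
      jetAlong ζ y = 0 ↔ ∃ z : Fin 2 → ℂ, dist z t < δ ∧ IsSingAt (toPoly y.1) z ∧
        eval z (toPoly y.2.1) = 0 ∧ eval z (toPoly y.2.2) = 0 := by
  rw [nhds_prod_eq, Filter.eventually_prod_iff] at hz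
  obtain ⟨p, hp, q, hq, hpq⟩ := hz
  obtain ⟨ε, hε, hεq⟩ := Metric.eventually_nhds_iff.1 hq
  filter_upwards [Ioo_mem_nhdsGT hε] with δ hδ
  have hsnd : Filter.Tendsto (fun y : Coef L × Coef L' × Coef L'' => y.2) (𝓝 (P, Q, R))
      (𝓝 (Q, R)) := continuous_snd.continuousAt
  have hζ' : Filter.Tendsto ζ (𝓝 (Q, R)) (𝓝 t) := by
    rw [← hζt]; exact hζ
  have h0 : ∀ᶠ z in 𝓝 t, z 0 ≠ 0 := (continuous_apply 0).continuousAt.eventually_ne ht0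
  have h1 : ∀ᶠ z in 𝓝 t, z 1 ≠ 0 := (continuous_apply 1).continuousAt.eventually_ne ht1
  filter_upwards [hsnd.eventually hp, (hζ'.comp hsnd).eventually h0, (hζ'.comp hsnd).eventually h1,
    (hζ'.comp hsnd).eventually (Metric.ball_mem_nhds t hδ.1)] with y hy hy0 hy1 hyδ
  have hjet : jetAlong ζ y = 0 ↔ eval (ζ y.2) (toPoly y.1) = 0 ∧
      eval (ζ y.2) (pderiv 0 (toPoly y.1)) = 0 ∧ eval (ζ y.2) (pderiv 1 (toPoly y.1)) = 0 := by
    simp [jetAlong, _root_.funext_iff, Fin.forall_fin_succ]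
  rw [hjet]
  constructor
  · rintro ⟨e0, e1, e2⟩
    have hyδ' : dist (ζ y.2) t < δ := hyδ
    exact ⟨ζ y.2, hyδ', ⟨hy0, hy1, e0, e1, e2⟩,
      (hpq hy (hεq (hyδ'.trans hδ.2))).2 rfl⟩
  · rintro ⟨z, hzδ, hsing, hQz⟩
    have : ζ y.2 = z := (hpq hy (hεq (hzδ.trans hδ.2))).1 hQz
    rw [this]
    exact hsing.2.2

theorem fderiv_jetAlong_inl {L L' L'' : Finset (ℕ × ℕ)} {N : ℕ}
    {ζ : Fin N → Coef L' × Coef L'' → (Fin 2 → ℂ)} {y : Coef L × Coef L' × Coef L''}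
    (hζ : ∀ h, AnalyticAt ℂ (ζ h) y.2) (c : Coef L) :
    fderiv ℂ (fun y => (fun h => jetAlong (ζ h) y : Fin N → Fin 3 → ℂ)) y (c, 0) =
      fun h => jetAlong (ζ h) (c, y.2) := by
  let J : Coef L →ₗ[ℂ] (Fin N → Fin 3 → ℂ) := LinearMap.pi fun h => LinearMap.pi
    ![(aeval (ζ h y.2)).toLinearMap ∘ₗ toPolyL L,
      (aeval (ζ h y.2)).toLinearMap ∘ₗ (pderiv 0).toLinearMap ∘ₗ toPolyL L,
      (aeval (ζ h y.2)).toLinearMap ∘ₗ (pderiv 1).toLinearMap ∘ₗ toPolyL L]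
  have hJ : ∀ c, J c = fun h => jetAlong (ζ h) (c, y.2) := by
    intro c
    ext h i
    fin_cases i <;> rfl
  have hA : AnalyticAt ℂ (fun y => (fun h => jetAlong (ζ h) y : Fin N → Fin 3 → ℂ)) y :=
    analyticAt_pi_iff.2 fun h => analyticAt_jetAlong (hζ h)
  have h1 := HasFDerivAt.comp y.1 (f := fun c => (c, y.2)) hA.differentiableAt.hasFDerivAt
    (hasFDerivAt_prodMk_left y.1 y.2)
  have h2 : HasFDerivAt (fun c => J c) (LinearMap.toContinuousLinearMap J) y.1 :=
    (LinearMap.toContinuousLinearMap J).hasFDerivAt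
  have h3 := DFunLike.congr_fun (h1.unique (h2.congr_of_eventuallyEq
    (Filter.Eventually.of_forall fun c => (hJ c).symm))) c
  rw [← hJ]
  exact h3

/-- Let `{P₀ = 0}` be irreducible with exactly `N` nondegenerate double
points `t₁, …, t_N` in `(ℂ*)²` and no other singular points, and let `{Q₀=0}`, `{R₀=0}`
meet transversely at each `t_h`. If `2N < b(Δ)`, then near `(P₀, Q₀, R₀)` the
codimension-3 loci `S'_h` of triples `(P, Q, R)` such that `P` has a double point near
`t_h` at which both `Q` and `R` vanish are cut out by analytic submersions and intersect
transversally. -/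
theorem transversality_of_S_primes
    (L L' L'' : Finset (ℕ × ℕ))
    (hL : IsLatticePolytopeSet L) (hL' : IsLatticePolytopeSet L')
    (hL'' : IsLatticePolytopeSet L'')
    (N : ℕ) (P0 : Coef L) (Q0 : Coef L') (R0 : Coef L'')
    (hirr : Irreducible (toPoly P0))
    (t : Fin N → (Fin 2 → ℂ)) (htinj : Function.Injective t)
    (hnodes : ∀ h, IsNodeAt (toPoly P0) (t h))
    (honly : ∀ z : Fin 2 → ℂ, IsSingAt (toPoly P0) z → ∃ h, z = t h)
    (hQR0 : ∀ h, eval (t h) (toPoly Q0) = 0 ∧ eval (t h) (toPoly R0) = 0)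
    (htrans : ∀ h,
      eval (t h) (pderiv 0 (toPoly Q0)) * eval (t h) (pderiv 1 (toPoly R0)) -
        eval (t h) (pderiv 1 (toPoly Q0)) * eval (t h) (pderiv 0 (toPoly R0)) ≠ 0)
    (hcount : 2 * N < boundaryLatticeCount L) :
    ∃ δ : ℝ, 0 < δ ∧
      ∃ W : Set (Coef L × Coef L' × Coef L''), IsOpen W ∧ (P0, Q0, R0) ∈ W ∧
        ∃ φ : Fin N → (Coef L × Coef L' × Coef L'') → (Fin 3 → ℂ),
          (∀ h, AnalyticOnNhd ℂ (φ h) W) ∧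
          -- `S'_h ∩ W` is the zero set of `φ_h`:
          (∀ h, ∀ y ∈ W, (φ h y = 0 ↔
            ∃ z : Fin 2 → ℂ, dist z (t h) < δ ∧ IsSingAt (toPoly y.1) z ∧
              eval z (toPoly y.2.1) = 0 ∧ eval z (toPoly y.2.2) = 0)) ∧
          -- each `S'_h` is smooth of codimension 3:
          (∀ h, ∀ y ∈ W, φ h y = 0 → Function.Surjective (fderiv ℂ (φ h) y)) ∧
          -- and `S'_1 ∩ ⋯ ∩ S'_N ∩ W` is a transversal intersection:
          (∀ y ∈ W, (∀ h, φ h y = 0) →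
            Function.Surjective
              (fderiv ℂ (fun y' => (fun h => φ h y' : Fin N → Fin 3 → ℂ)) y)) := by
  have hex := fun h => exists_implicit_zero (hQR0 h).1 (hQR0 h).2 (htrans h)
  choose ζ hζ hζt hζz using hex
  set y0 : Coef L × Coef L' × Coef L'' := (P0, Q0, R0) with hy0
  let Φ : Coef L × Coef L' × Coef L'' → (Fin N → Fin 3 → ℂ) := fun y h => jetAlong (ζ h) y
  have hloc := Filter.eventually_all.2 fun h => eventually_jetAlong_eq_zero_iff
    (hnodes h).1.1 (hnodes h).1.2.1 (hζ h).continuousAt (hζt h) (hζz h) P0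
  obtain ⟨δ, hδ, hδ0⟩ := (hloc.and self_mem_nhdsWithin).exists
  have hφ : ∀ h, AnalyticAt ℂ (jetAlong (L := L) (ζ h)) y0 := fun h => analyticAt_jetAlong (hζ h)
  have hΦ : AnalyticAt ℂ Φ y0 := analyticAt_pi_iff.2 hφ
  have hsurj : Function.Surjective (fderiv ℂ Φ y0) := by
    intro v
    obtain ⟨c, hc⟩ := exists_jets_eq hL hirr htinj hnodes hcount v
    refine ⟨(c, 0), (fderiv_jetAlong_inl hζ c).trans ?_⟩
    ext h i
    obtain ⟨h0, h1, h2⟩ := hc h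
    fin_cases i <;> simp [jetAlong, hy0, hζt, h0, h1, h2]
  obtain ⟨W, hW, hWo, hyW⟩ := eventually_nhds_iff.1
    ((Filter.eventually_all.2 fun h => (hφ h).eventually_analyticAt).and
      ((eventually_surjective_fderiv hΦ hsurj).and (Filter.eventually_all.2 hδ)))
  refine ⟨δ, hδ0, W, hWo, hyW, fun h => jetAlong (ζ h), fun h y hy => (hW y hy).1 h,
    fun h y hy => (hW y hy).2.2 h, fun h y hy _ v => ?_, fun y hy _ => (hW y hy).2.1⟩
  have hd : HasFDerivAt Φ (fderiv ℂ Φ y) y :=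
    (analyticAt_pi_iff.2 (hW y hy).1 : AnalyticAt ℂ Φ y).differentiableAt.hasFDerivAt
  obtain ⟨w, hw⟩ := (hW y hy).2.1 (Pi.single h v)
  refine ⟨w, ?_⟩
  have hdh : fderiv ℂ (jetAlong (ζ h)) y = _ := (hasFDerivAt_pi'.1 hd h).fderiv
  rw [hdh]
  exact (congrFun hw h).trans (by simp)
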